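/- arXiv:1911.02856 — 3 statements merged into one kernel-verified Lean document; each statement's English description precedes it below -/
import Mathlib

section
/- Let g = e^{2u} g_euc be a smooth conformal metric on the annulus D_4 \ D_{1/4} with ‖∇u‖_{L^{2,∞}(D_4 \ D_{1/4})} < Λ₃, and let c be the mean value of u on the circle ∂D_{3/2}. Then there exists ε₂ = ε₂(Λ₃) > 0 such that if ∫_{D_4 \ D_{1/2}} |K(g)| e^{2u} < ε₂, then C₁ ≤ d_g(e^{iθ}, 2e^{iθ'}) / e^{c} ≤ C₂ for all angles θ, θ', and C₁' ≤ μ(D_2 \ D, g) / e^{2c} ≤ C₂', where C₁, C₂, C₁', C₂' depend only on Λ₃ and ε₂. -/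
open MeasureTheory Filter Metric
open scoped Topology ENNReal

noncomputable section

/-- The Laplacian of `u : ℂ → ℝ` (sum of the two pure second derivatives). -/
def lap (u : ℂ → ℝ) (x : ℂ) : ℝ :=
  iteratedFDeriv ℝ 2 u x ![1, 1] + iteratedFDeriv ℝ 2 u x ![Complex.I, Complex.I]

/-- Gauss curvature of the conformal metric `e^{2u} g_euc`: `K = -e^{-2u} Δu`. -/
def gauss (u : ℂ → ℝ) (x : ℂ) : ℝ := -Real.exp (-(2 * u x)) * lap u x

/-- Area `μ(A, g)` of a set for the metric `g = e^{2u} g_euc`. -/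
def confAreaE (u : ℂ → ℝ) (A : Set ℂ) : ℝ≥0∞ :=
  ∫⁻ x in A, ENNReal.ofReal (Real.exp (2 * u x))

/-- Total curvature `∫_A |K(g)| dμ_g` of the metric `g = e^{2u} g_euc`. -/
def curvIntE (u : ℂ → ℝ) (A : Set ℂ) : ℝ≥0∞ :=
  ∫⁻ x in A, ENNReal.ofReal (|gauss u x| * Real.exp (2 * u x))

/-- `C¹` paths from `x` to `y` staying in `S`. -/
def PathsIn (S : Set ℂ) (x y : ℂ) : Set (ℝ → ℂ) :=
  {γ | γ 0 = x ∧ γ 1 = y ∧ (∀ t ∈ Set.Icc (0:ℝ) 1, γ t ∈ S) ∧ ContDiff ℝ 1 γ}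

/-- Length of a path for the metric `e^{2u} g_euc`. -/
def confLen (u : ℂ → ℝ) (γ : ℝ → ℂ) : ℝ :=
  ∫ t in (0:ℝ)..1, Real.exp (u (γ t)) * ‖deriv γ t‖

/-- Geodesic distance (within `S`) of the conformal metric `e^{2u} g_euc`. -/
def confDist (u : ℂ → ℝ) (S : Set ℂ) (x y : ℂ) : ℝ :=
  sInf (confLen u '' PathsIn S x y)

/-- Metric ball `B_r^g(z)` of the conformal metric (within `S`). -/
def confBall (u : ℂ → ℝ) (S : Set ℂ) (z : ℂ) (r : ℝ) : Set ℂ :=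
  {x ∈ S | confDist u S z x < r}

/-- `‖f‖_{L^{2,∞}(Ω)} ≤ C`, i.e. `t·|{|f| > t}|^{1/2} ≤ C` for all `t > 0`. -/
def wL2Bound (f : ℂ → ℝ) (Ω : Set ℂ) (C : ℝ) : Prop :=
  ∀ t : ℝ, 0 < t → t * (volume {x ∈ Ω | t < |f x|}).toReal ^ ((1:ℝ)/2) ≤ C

/-- The `W^{1,p}(Ω)` norm of a differentiable function (via its classical gradient). -/
def w1pNormE (u : ℂ → ℝ) (Ω : Set ℂ) (p : ℝ) : ℝ≥0∞ :=
  (∫⁻ x in Ω, ENNReal.ofReal (|u x| ^ p)) ^ (1/p)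
    + (∫⁻ x in Ω, ENNReal.ofReal (‖fderiv ℝ u x‖ ^ p)) ^ (1/p)

/-- Real dot product on `ℂ = ℝ²`. -/
def dotC (a b : ℂ) : ℝ := a.re * b.re + a.im * b.im

/-- `V` is the distributional (weak) gradient of `u` on `Ω`. -/
def IsWeakGradOn (Ω : Set ℂ) (u : ℂ → ℝ) (V : ℂ → ℂ) : Prop :=
  ∀ φ : ℂ → ℝ, ContDiff ℝ (⊤ : ℕ∞) φ → HasCompactSupport φ → tsupport φ ⊆ Ω →
    ∀ w : ℂ, ∫ x in Ω, u x * fderiv ℝ φ x w = -∫ x in Ω, dotC (V x) w * φ x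

/-- `v k → u` weakly in `W^{1,p}(Ω)`: uniformly bounded `W^{1,p}` norms together with
convergence, tested against smooth compactly supported functions, of the functions and of
their weak gradients. -/
def WeakW1pLim (Ω : Set ℂ) (p : ℝ) (v : ℕ → ℂ → ℝ) (u : ℂ → ℝ) : Prop :=
  ∃ V : ℕ → ℂ → ℂ,
    (∀ k, IsWeakGradOn Ω (v k) (V k)) ∧
    (∃ C : ℝ, ∀ k, (∫ x in Ω, |v k x| ^ p) ^ (1/p)
        + (∫ x in Ω, ‖V k x‖ ^ p) ^ (1/p) ≤ C) ∧
    (∀ φ : ℂ → ℝ, ContDiff ℝ (⊤ : ℕ∞) φ → HasCompactSupport φ → tsupport φ ⊆ Ω →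
      Tendsto (fun k => ∫ x in Ω, v k x * φ x) atTop (𝓝 (∫ x in Ω, u x * φ x)) ∧
      ∀ w : ℂ, Tendsto (fun k => ∫ x in Ω, dotC (V k x) w * φ x) atTop
        (𝓝 (-∫ x in Ω, u x * fderiv ℝ φ x w)))

/-- Mean value of `φ` on a set. -/
def avgOn (φ : ℂ → ℝ) (A : Set ℂ) : ℝ := (volume A).toReal⁻¹ * ∫ x in A, φ x

/-- Mean oscillation of `φ` on the disk `D_t(x₀)`. -/
def meanOsc (φ : ℂ → ℝ) (x₀ : ℂ) (t : ℝ) : ℝ :=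
  avgOn (fun x => |φ x - avgOn φ (ball x₀ t)|) (ball x₀ t)

/-- The John–Nirenberg radius `ρ(φ, x₀, Ω, λ)`. -/
def jnRad (φ : ℂ → ℝ) (x₀ : ℂ) (Ω : Set ℂ) (lam : ℝ) : ℝ :=
  sSup {r : ℝ | 0 ≤ r ∧ ∀ t : ℝ, 0 < t → t < r → ball x₀ t ⊆ Ω ∧ meanOsc φ x₀ t ≤ lam}

/-- Mean value of `u` along the circle `∂D_r(0)`. -/
def circMean (u : ℂ → ℝ) (r : ℝ) : ℝ :=
  (2 * Real.pi)⁻¹ * ∫ θ in (0:ℝ)..(2 * Real.pi), u ((r : ℂ) * Complex.exp ((θ : ℂ) * Complex.I))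

/-- Completeness of the conformal metric `e^{2v} g_euc` on all of `ℂ`. -/
def ConfComplete (v : ℂ → ℝ) : Prop :=
  ∀ x : ℕ → ℂ,
    (∀ ε : ℝ, 0 < ε → ∃ N : ℕ, ∀ m ≥ N, ∀ n ≥ N, confDist v Set.univ (x m) (x n) < ε) →
    ∃ l : ℂ, Tendsto (fun n => confDist v Set.univ (x n) l) atTop (𝓝 0)

/-- `(D, g_k)` extends to a complete conformal surface with total curvature at most `Λ`. -/
def ExtendsComplete (u : ℂ → ℝ) (Λ : ℝ) : Prop :=
  ∃ v : ℂ → ℝ, ContDiff ℝ (⊤ : ℕ∞) v ∧ Set.EqOn v u (ball (0:ℂ) 1) ∧ ConfComplete v ∧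
    curvIntE v Set.univ ≤ ENNReal.ofReal Λ

/-- Gromov–Hausdorff convergence of `(S, dk k)` to `(S, d)`, phrased through
correspondences of small distortion. -/
def GHTendsto (S : Set ℂ) (dk : ℕ → ℂ → ℂ → ℝ) (d : ℂ → ℂ → ℝ) : Prop :=
  ∀ ε : ℝ, 0 < ε → ∀ᶠ k in atTop, ∃ R : Set (ℂ × ℂ),
    (∀ p ∈ R, p.1 ∈ S ∧ p.2 ∈ S) ∧
    (∀ x ∈ S, ∃ y ∈ S, (x, y) ∈ R) ∧
    (∀ y ∈ S, ∃ x ∈ S, (x, y) ∈ R) ∧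
    (∀ p ∈ R, ∀ q ∈ R, |dk k p.1 q.1 - d p.2 q.2| < ε)

/-- `−Δu = f` on `Ω` in the sense of distributions. -/
def DistribLaplaceEq (Ω : Set ℂ) (u f : ℂ → ℝ) : Prop :=
  ∀ φ : ℂ → ℝ, ContDiff ℝ (⊤ : ℕ∞) φ → HasCompactSupport φ → tsupport φ ⊆ Ω →
    -∫ x in Ω, u x * lap φ x = ∫ x in Ω, f x * φ x

theorem param_deriv (F F' : ℝ → ℝ → ℝ) (a b : ℝ) (hF : ∀ r, Continuous (F r))
    (hF' : Continuous (fun p : ℝ × ℝ => F' p.1 p.2))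
    (hd : ∀ r θ, HasDerivAt (fun r => F r θ) (F' r θ) r) (r₀ : ℝ) :
    HasDerivAt (fun r => ∫ θ in a..b, F r θ) (∫ θ in a..b, F' r₀ θ) r₀ := by
  have hK : IsCompact (closedBall r₀ 1 ×ˢ Set.uIcc a b) :=
    (isCompact_closedBall r₀ 1).prod isCompact_uIcc
  obtain ⟨C, hC⟩ := hK.exists_bound_of_continuousOn hF'.continuousOn
  refine (intervalIntegral.hasDerivAt_integral_of_dominated_loc_of_deriv_le
    (F := F) (F' := F') (bound := fun _ => C) (s := closedBall r₀ 1)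
    (closedBall_mem_nhds r₀ one_pos) ?_ ?_ ?_ ?_ ?_ ?_).2
  · exact Eventually.of_forall fun r => (hF r).aestronglyMeasurable
  · exact (hF r₀).intervalIntegrable _ _
  · exact (hF'.comp (by fun_prop : Continuous fun θ : ℝ => (r₀, θ))).aestronglyMeasurable
  · refine Eventually.of_forall fun t ht x hx => hC (x, t) ⟨hx, Set.uIoc_subset_uIcc ht⟩
  · exact continuous_const.intervalIntegrable _ _
  · exact Eventually.of_forall fun t _ x _ => hd x t

theorem polar_ann (x : ℂ) (G : ℂ → ℝ≥0∞) (hG : Measurable G) (a b : ℝ) (ha : 0 ≤ a) :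
    ∫⁻ r in Set.Ioc a b, ∫⁻ θ in Set.Ioc (-Real.pi) Real.pi,
      ENNReal.ofReal r * G (x + r * Complex.exp (θ * Complex.I)) =
    ∫⁻ y in {y | a < ‖y - x‖ ∧ ‖y - x‖ ≤ b}, G y := by
  have hS : MeasurableSet {y : ℂ | a < ‖y - x‖ ∧ ‖y - x‖ ≤ b} := by
    apply MeasurableSet.inter
    · exact measurableSet_lt measurable_const (by fun_prop : Measurable fun y : ℂ => ‖y - x‖)
    · exact measurableSet_le (by fun_prop : Measurable fun y : ℂ => ‖y - x‖) measurable_const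
  rw [← lintegral_indicator hS]
  rw [← lintegral_add_left_eq_self _ x, ← Complex.lintegral_comp_polarCoord_symm]
  have hm : Measurable fun p : ℝ × ℝ => ENNReal.ofReal p.1 *
      G (x + p.1 * Complex.exp (p.2 * Complex.I)) := by
    apply Measurable.mul (by fun_prop)
    exact hG.comp (by fun_prop)
  have h1 := lintegral_prod (μ := volume.restrict (Set.Ioc a b))
    (ν := volume.restrict (Set.Ioc (-Real.pi) Real.pi)) _ hm.aemeasurable
  simp only at h1
  rw [← h1, Measure.prod_restrict, ← Measure.volume_eq_prod]
  rw [← lintegral_indicator (measurableSet_Ioc.prod measurableSet_Ioc)]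
  have ht : MeasurableSet (polarCoord.target) := polarCoord.open_target.measurableSet
  rw [← lintegral_indicator ht]
  have hpi : ∀ᵐ p : ℝ × ℝ, p.2 ≠ Real.pi := by
    have : volume {p : ℝ × ℝ | p.2 = Real.pi} = 0 := by
      have : {p : ℝ × ℝ | p.2 = Real.pi} = Set.univ ×ˢ {Real.pi} := by ext; simp
      rw [this, Measure.volume_eq_prod, Measure.prod_prod]; simp
    rw [ae_iff]; simpa using this
  refine lintegral_congr_ae ?_
  filter_upwards [hpi] with p hp
  have e1 : (Complex.polarCoord.symm p) = p.1 * Complex.exp (p.2 * Complex.I) := by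
    rw [Complex.polarCoord_symm_apply, Complex.exp_mul_I]; simp
  simp only [Set.indicator_apply, polarCoord_target, Set.mem_prod, Set.mem_Ioc, Set.mem_Ioi,
    Set.mem_Ioo, e1, smul_eq_mul, Set.mem_ofPred_eq, add_sub_cancel_left, norm_mul,
    Complex.norm_exp_ofReal_mul_I, mul_one, Complex.norm_real, Real.norm_eq_abs]
  by_cases h0 : 0 < p.1
  · rw [abs_of_pos h0]
    have : (p.2 ≤ Real.pi) ↔ p.2 < Real.pi := ⟨fun h => lt_of_le_of_ne h hp, le_of_lt⟩
    simp only [this, h0, true_and]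
    split_ifs <;> simp_all
  · have : ¬ a < p.1 := fun h => h0 (ha.trans_lt h)
    simp [h0, this]

/-- point on circle -/
def cpt (x : ℂ) (r θ : ℝ) : ℂ := x + r * Complex.exp (θ * Complex.I)

theorem cpt_cont (x : ℂ) : Continuous fun p : ℝ × ℝ => cpt x p.1 p.2 := by
  unfold cpt; fun_prop

theorem cpt_dr (x : ℂ) (r θ : ℝ) :
    HasDerivAt (fun r => cpt x r θ) (Complex.exp (θ * Complex.I)) r := by
  unfold cpt
  have h : HasDerivAt (fun r : ℝ => (r : ℂ)) 1 r := Complex.ofRealCLM.hasDerivAt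
  simpa using (h.mul_const (Complex.exp (θ * Complex.I))).const_add x

theorem e_dθ (θ : ℝ) :
    HasDerivAt (fun θ : ℝ => Complex.exp (θ * Complex.I))
      (Complex.I * Complex.exp (θ * Complex.I)) θ := by
  have h : HasDerivAt (fun r : ℝ => (r : ℂ)) 1 θ := Complex.ofRealCLM.hasDerivAt
  have := (h.mul_const Complex.I).cexp
  simpa [mul_comm] using this

theorem cpt_dθ (x : ℂ) (r θ : ℝ) :
    HasDerivAt (fun θ => cpt x r θ) (r * (Complex.I * Complex.exp (θ * Complex.I))) θ := by
  unfold cpt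
  exact ((e_dθ θ).const_mul (r:ℂ)).const_add x

theorem lap_eq (v : ℂ → ℝ) (y e : ℂ) (he : e.re ^ 2 + e.im ^ 2 = 1) :
    lap v y = fderiv ℝ (fderiv ℝ v) y e e +
      fderiv ℝ (fderiv ℝ v) y (Complex.I * e) (Complex.I * e) := by
  unfold lap
  rw [iteratedFDeriv_two_apply, iteratedFDeriv_two_apply]
  set B := fderiv ℝ (fderiv ℝ v) y
  have h1 : e = e.re • (1:ℂ) + e.im • Complex.I := by
    apply Complex.ext <;> simp
  have h2 : Complex.I * e = (-e.im) • (1:ℂ) + e.re • Complex.I := by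
    apply Complex.ext <;> simp
  rw [h2]
  set a := e.re
  set b := e.im
  rw [h1]
  simp only [map_add, map_smul, add_apply, smul_apply,
    smul_eq_mul, Matrix.cons_val_zero, Matrix.cons_val_one]
  linear_combination (-(B 1 1) - B Complex.I Complex.I) * he

theorem lap_cont (v : ℂ → ℝ) (hv : ContDiff ℝ (⊤ : ℕ∞) v) : Continuous (lap v) := by
  have h : Continuous (fderiv ℝ (fderiv ℝ v)) := by
    have : ContDiff ℝ 1 (fderiv ℝ v) := hv.fderiv_right (by norm_cast)
    exact this.continuous_fderiv (by norm_num)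
  unfold lap
  simp only [iteratedFDeriv_two_apply]
  fun_prop

/-- mean over circle -/
def cmean (v : ℂ → ℝ) (x : ℂ) (r : ℝ) : ℝ :=
  (2 * Real.pi)⁻¹ * ∫ θ in (-Real.pi)..Real.pi, v (cpt x r θ)

def cmean1 (v : ℂ → ℝ) (x : ℂ) (r : ℝ) : ℝ :=
  (2 * Real.pi)⁻¹ * ∫ θ in (-Real.pi)..Real.pi,
    fderiv ℝ v (cpt x r θ) (Complex.exp (θ * Complex.I))

theorem cmean_deriv (v : ℂ → ℝ) (hv : ContDiff ℝ (⊤ : ℕ∞) v) (x : ℂ) (r : ℝ) :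
    HasDerivAt (cmean v x) (cmean1 v x r) r := by
  unfold cmean cmean1
  apply HasDerivAt.const_mul
  have hc := cpt_cont x
  have hd : Continuous (fderiv ℝ v) := hv.continuous_fderiv (by simp)
  apply param_deriv (fun r θ => v (cpt x r θ))
    (fun r θ => fderiv ℝ v (cpt x r θ) (Complex.exp (θ * Complex.I)))
  · intro r
    exact hv.continuous.comp (hc.comp (by fun_prop : Continuous fun θ : ℝ => (r, θ)))
  · exact (hd.comp hc).clm_apply (by fun_prop)
  · intro r θ
    exact ((hv.differentiable (by simp)) _).hasFDerivAt.comp_hasDerivAt r (cpt_dr x r θ)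

theorem exp_pi_eq : Complex.exp ((Real.pi : ℂ) * Complex.I) =
    Complex.exp (((-Real.pi : ℝ) : ℂ) * Complex.I) := by
  rw [Complex.exp_pi_mul_I]; push_cast
  rw [neg_mul, Complex.exp_neg, Complex.exp_pi_mul_I]; norm_num

theorem exp_sq (θ : ℝ) : (Complex.exp (θ * Complex.I)).re ^ 2 +
    (Complex.exp (θ * Complex.I)).im ^ 2 = 1 := by
  rw [Complex.exp_ofReal_mul_I_re, Complex.exp_ofReal_mul_I_im]
  exact Real.cos_sq_add_sin_sq θ

theorem rcmean1_deriv (v : ℂ → ℝ) (hv : ContDiff ℝ (⊤ : ℕ∞) v) (x : ℂ) (r : ℝ) :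
    HasDerivAt (fun r => r * cmean1 v x r) (r * cmean (lap v) x r) r := by
  have hc := cpt_cont x
  have hv1 : ContDiff ℝ (⊤ : ℕ∞) (fderiv ℝ v) := hv.fderiv_right (by norm_cast)
  have hd : Continuous (fderiv ℝ v) := hv1.continuous
  have hd2 : Continuous (fderiv ℝ (fderiv ℝ v)) := hv1.continuous_fderiv (by simp)
  have key : HasDerivAt (fun r => ∫ θ in (-Real.pi)..Real.pi,
      r * fderiv ℝ v (cpt x r θ) (Complex.exp (θ * Complex.I)))
      (∫ θ in (-Real.pi)..Real.pi, (1 * fderiv ℝ v (cpt x r θ) (Complex.exp (θ * Complex.I)) +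
        r * fderiv ℝ (fderiv ℝ v) (cpt x r θ) (Complex.exp (θ * Complex.I))
          (Complex.exp (θ * Complex.I)))) r := by
    apply param_deriv (fun r θ => r * fderiv ℝ v (cpt x r θ) (Complex.exp (θ * Complex.I)))
      (fun r θ => (1 * fderiv ℝ v (cpt x r θ) (Complex.exp (θ * Complex.I)) +
        r * fderiv ℝ (fderiv ℝ v) (cpt x r θ) (Complex.exp (θ * Complex.I))
          (Complex.exp (θ * Complex.I))))
    · intro r
      refine continuous_const.mul (Continuous.clm_apply ?_ (by fun_prop))
      exact hd.comp (hc.comp (by fun_prop : Continuous fun θ : ℝ => (r, θ)))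
    · refine (continuous_const.mul (Continuous.clm_apply (hd.comp hc) (by fun_prop))).add
        (continuous_fst.mul (Continuous.clm_apply (Continuous.clm_apply (hd2.comp hc) ?_) ?_)) <;>
      fun_prop
    · intro r θ
      refine (hasDerivAt_id r).mul ?_
      have h1 := ((hv1.differentiable (by simp)) (cpt x r θ)).hasFDerivAt.comp_hasDerivAt r
        (cpt_dr x r θ)
      have := h1.clm_apply (hasDerivAt_const r (Complex.exp (θ * Complex.I)))
      simpa using this
  have hparts : ∫ θ in (-Real.pi)..Real.pi,
      (r * fderiv ℝ (fderiv ℝ v) (cpt x r θ) (Complex.I * Complex.exp (θ * Complex.I))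
          (Complex.I * Complex.exp (θ * Complex.I))
        - fderiv ℝ v (cpt x r θ) (Complex.exp (θ * Complex.I))) = 0 := by
    have hh : ∀ θ ∈ Set.uIcc (-Real.pi) Real.pi, HasDerivAt
        (fun θ : ℝ => fderiv ℝ v (cpt x r θ) (Complex.I * Complex.exp (θ * Complex.I)))
        (r * fderiv ℝ (fderiv ℝ v) (cpt x r θ) (Complex.I * Complex.exp (θ * Complex.I))
          (Complex.I * Complex.exp (θ * Complex.I))
        - fderiv ℝ v (cpt x r θ) (Complex.exp (θ * Complex.I))) θ := by
      intro θ _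
      have h1 := ((hv1.differentiable (by simp)) (cpt x r θ)).hasFDerivAt.comp_hasDerivAt θ
        (cpt_dθ x r θ)
      have h2 := h1.clm_apply ((e_dθ θ).const_mul Complex.I)
      refine h2.congr_deriv ?_
      rw [← mul_assoc Complex.I Complex.I, Complex.I_mul_I, neg_one_mul, map_neg,
        ← Complex.real_smul, map_smul]
      simp [sub_eq_add_neg]
    rw [intervalIntegral.integral_eq_sub_of_hasDerivAt hh]
    · rw [exp_pi_eq]
      have : cpt x r Real.pi = cpt x r (-Real.pi) := by
        unfold cpt; rw [exp_pi_eq]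
      rw [this, sub_self]
    · apply Continuous.intervalIntegrable
      have hcc : Continuous fun θ => cpt x r θ := hc.comp (by fun_prop : Continuous fun θ : ℝ => (r, θ))
      refine (continuous_const.mul (Continuous.clm_apply (Continuous.clm_apply (hd2.comp hcc) ?_) ?_)).sub
        (Continuous.clm_apply (hd.comp hcc) (by fun_prop)) <;>
      fun_prop
  have e1 : (fun r => r * cmean1 v x r) = fun r => (2 * Real.pi)⁻¹ *
      ∫ θ in (-Real.pi)..Real.pi,
      r * fderiv ℝ v (cpt x r θ) (Complex.exp (θ * Complex.I)) := by
    ext r; unfold cmean1; rw [intervalIntegral.integral_const_mul]; ring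
  rw [e1]
  refine (key.const_mul (2 * Real.pi)⁻¹).congr_deriv ?_
  symm
  unfold cmean
  rw [mul_left_comm, ← intervalIntegral.integral_const_mul]
  congr 1
  have hcc : Continuous fun θ => cpt x r θ := hc.comp (by fun_prop : Continuous fun θ : ℝ => (r, θ))
  rw [← sub_eq_zero, ← intervalIntegral.integral_sub, ← hparts]
  · congr 1; ext θ
    rw [lap_eq v _ _ (exp_sq θ)]
    ring
  · exact (continuous_const.mul ((lap_cont v hv).comp hcc)).intervalIntegrable _ _
  · apply Continuous.intervalIntegrable
    refine (continuous_const.mul (Continuous.clm_apply (hd.comp hcc) (by fun_prop))).add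
        (continuous_const.mul (Continuous.clm_apply (Continuous.clm_apply (hd2.comp hcc) ?_) ?_)) <;>
      fun_prop

theorem cmean_cont (v : ℂ → ℝ) (hv : Continuous v) (x : ℂ) : Continuous (cmean v x) := by
  unfold cmean
  apply continuous_const.mul
  apply intervalIntegral.continuous_parametric_intervalIntegral_of_continuous'
  exact hv.comp (cpt_cont x)

theorem cmean_zero (v : ℂ → ℝ) (x : ℂ) : cmean v x 0 = v x := by
  unfold cmean cpt
  simp
  have := Real.pi_pos
  field_simp
  ring

theorem green (v : ℂ → ℝ) (hv : ContDiff ℝ (⊤ : ℕ∞) v) (x : ℂ) (R : ℝ) (hR : 0 < R) :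
    cmean v x R - v x = ∫ r in (0:ℝ)..R, -(Real.log r - Real.log R) * (r * cmean (lap v) x r) := by
  have hc1 : Continuous (cmean1 v x) := by
    unfold cmean1
    apply continuous_const.mul
    apply intervalIntegral.continuous_parametric_intervalIntegral_of_continuous'
    exact Continuous.clm_apply ((hv.continuous_fderiv (by simp)).comp (cpt_cont x)) (by fun_prop)
  have hcl := cmean_cont _ (lap_cont v hv) x
  have := intervalIntegral.integral_eq_sub_of_hasDerivAt_of_le (a := 0) (b := R)
    (f := fun r => cmean v x r - (Real.log r - Real.log R) * (r * cmean1 v x r))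
    (f' := fun r => -(Real.log r - Real.log R) * (r * cmean (lap v) x r)) hR.le ?_ ?_ ?_
  · rw [this]; simp [cmean_zero]
  · apply Continuous.continuousOn
    have : (fun r => cmean v x r - (Real.log r - Real.log R) * (r * cmean1 v x r)) =
      fun r => cmean v x r - (r * Real.log r - r * Real.log R) * (cmean1 v x r) := by
      ext r; ring
    rw [this]
    exact (cmean_cont v hv.continuous x).sub (((Real.continuous_mul_log).sub
      (continuous_id.mul continuous_const)).mul hc1)
  · intro r hr
    have h1 := cmean_deriv v hv x r
    have h2 := rcmean1_deriv v hv x r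
    have h3 := (Real.hasDerivAt_log hr.1.ne').sub_const (Real.log R)
    refine (h1.sub (h3.mul h2)).congr_deriv ?_
    have := hr.1.ne'
    field_simp
    ring
  · apply Continuous.intervalIntegrable
    have : (fun r => -(Real.log r - Real.log R) * (r * cmean (lap v) x r)) =
      fun r => -(r * Real.log r - r * Real.log R) * (cmean (lap v) x r) := by
      ext r; ring
    rw [this]
    exact ((Real.continuous_mul_log).sub
      (continuous_id.mul continuous_const)).neg.mul hcl

/-- kernel -/
def kk (s : ℝ) : ℝ := max 0 (-Real.log (4 * s))

theorem kk_meas : Measurable kk := by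
  unfold kk
  exact measurable_const.max (Real.measurable_log.comp (by fun_prop)).neg

/-- working annulus -/
def WW : Set ℂ := {y | 5/8 < ‖y - 0‖ ∧ ‖y - 0‖ ≤ 5/2}

theorem WW_meas : MeasurableSet WW := by
  apply MeasurableSet.inter
  · exact measurableSet_lt measurable_const (by fun_prop : Measurable fun y : ℂ => ‖y - 0‖)
  · exact measurableSet_le (by fun_prop : Measurable fun y : ℂ => ‖y - 0‖) measurable_const

/-- log potential -/
def Pot (v : ℂ → ℝ) (x : ℂ) : ℝ≥0∞ :=
  ∫⁻ y in WW, ENNReal.ofReal (kk ‖y - x‖) * ‖lap v y‖ₑ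

theorem sub_WW (x : ℂ) (h1 : 1 ≤ ‖x‖) (h2 : ‖x‖ ≤ 2) (a b : ℝ) (hb : b ≤ 1/4) :
    {y | a < ‖y - x‖ ∧ ‖y - x‖ ≤ b} ⊆ WW := by
  intro y hy
  have h3 : ‖y - x‖ ≤ 1/4 := hy.2.trans hb
  have h4 := norm_sub_norm_le x y
  have h5 := norm_sub_norm_le y x
  rw [norm_sub_rev] at h4
  refine ⟨?_, ?_⟩ <;> rw [sub_zero] <;> linarith

theorem cpt_norm (x : ℂ) (r θ : ℝ) (hr : 0 ≤ r) : ‖cpt x r θ - x‖ = r := by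
  unfold cpt
  simp [abs_of_nonneg hr]

theorem cpt_cont' (x : ℂ) (r : ℝ) : Continuous fun θ => cpt x r θ :=
  (cpt_cont x).comp (by fun_prop : Continuous fun θ : ℝ => (r, θ))

theorem pi2 : (-Real.pi) ≤ Real.pi := by linarith [Real.pi_pos]

theorem enorm_ii (f : ℝ → ℝ) (a b : ℝ) (hab : a ≤ b) :
    ‖∫ t in a..b, f t‖ₑ ≤ ∫⁻ t in Set.Ioc a b, ‖f t‖ₑ := by
  rw [intervalIntegral.integral_of_le hab]
  exact enorm_integral_le_lintegral_enorm _

theorem cmean_enorm (f : ℂ → ℝ) (x : ℂ) (r : ℝ) : ‖cmean f x r‖ₑ ≤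
    ENNReal.ofReal (2 * Real.pi)⁻¹ *
      ∫⁻ θ in Set.Ioc (-Real.pi) Real.pi, ‖f (cpt x r θ)‖ₑ := by
  unfold cmean
  rw [enorm_mul]
  gcongr
  · rw [Real.enorm_of_nonneg (by have := Real.pi_pos; positivity)]
  · exact enorm_ii _ _ _ pi2

theorem green_est (v : ℂ → ℝ) (hv : ContDiff ℝ (⊤ : ℕ∞) v) (x : ℂ) (h1 : 1 ≤ ‖x‖)
    (h2 : ‖x‖ ≤ 2) (R : ℝ) (hR : 0 < R) (hR' : R ≤ 1/4) :
    ‖cmean v x R - v x‖ₑ ≤ ENNReal.ofReal (2 * Real.pi)⁻¹ * Pot v x := by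
  rw [green v hv x R hR]
  refine (enorm_ii _ _ _ hR.le).trans ?_
  have hlc := lap_cont v hv
  have hG : Measurable fun y => ENNReal.ofReal (kk ‖y - x‖) * ‖lap v y‖ₑ := by
    exact Measurable.fun_mul (ENNReal.measurable_ofReal.comp (kk_meas.comp (by fun_prop)))
      hlc.measurable.enorm
  calc _ ≤ ∫⁻ r in Set.Ioc 0 R, ENNReal.ofReal (2 * Real.pi)⁻¹ *
      ∫⁻ θ in Set.Ioc (-Real.pi) Real.pi, ENNReal.ofReal r *
        (ENNReal.ofReal (kk ‖cpt x r θ - x‖) * ‖lap v (cpt x r θ)‖ₑ) := by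
        refine setLIntegral_mono' measurableSet_Ioc fun r hr => ?_
        have hk : ‖-(Real.log r - Real.log R)‖ₑ ≤ ENNReal.ofReal (kk r) := by
          have : 0 ≤ -(Real.log r - Real.log R) := by
            have := Real.log_le_log hr.1 hr.2; linarith
          rw [Real.enorm_of_nonneg this]
          apply ENNReal.ofReal_le_ofReal
          unfold kk
          refine le_max_of_le_right ?_
          rw [Real.log_mul (by norm_num) hr.1.ne']
          have h4 : Real.log R ≤ Real.log (1/4) := Real.log_le_log hR hR'
          rw [one_div, Real.log_inv] at h4
          linarith
        rw [enorm_mul, enorm_mul, Real.enorm_of_nonneg hr.1.le]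
        have e : ∀ θ, ‖cpt x r θ - x‖ = r := fun θ => cpt_norm x r θ hr.1.le
        simp only [e]
        rw [lintegral_const_mul', lintegral_const_mul']
        · calc _ ≤ ENNReal.ofReal (kk r) * (ENNReal.ofReal r * (ENNReal.ofReal (2 * Real.pi)⁻¹ *
              ∫⁻ θ in Set.Ioc (-Real.pi) Real.pi, ‖lap v (cpt x r θ)‖ₑ)) := by
                gcongr
                exact cmean_enorm _ _ _
            _ = _ := by ring
        · simp
        · simp
    _ = ENNReal.ofReal (2 * Real.pi)⁻¹ * ∫⁻ r in Set.Ioc 0 R,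
      ∫⁻ θ in Set.Ioc (-Real.pi) Real.pi, ENNReal.ofReal r *
        (ENNReal.ofReal (kk ‖cpt x r θ - x‖) * ‖lap v (cpt x r θ)‖ₑ) := by
        rw [lintegral_const_mul' _ _ (by simp)]
    _ ≤ _ := by
        gcongr
        unfold cpt
        rw [polar_ann x _ hG 0 R le_rfl]
        exact lintegral_mono_set (sub_WW x h1 h2 _ _ hR')

theorem mean_osc_circle (v : ℂ → ℝ) (hv : ContDiff ℝ (⊤ : ℕ∞) v) (r θ : ℝ) (hr : 0 ≤ r)
    (hθ : θ ∈ Set.Ioc (-Real.pi) Real.pi) :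
    ‖v (cpt 0 r θ) - cmean v 0 r‖ₑ ≤ ∫⁻ φ in Set.Ioc (-Real.pi) Real.pi,
      ENNReal.ofReal r * ‖fderiv ℝ v (cpt 0 r φ)‖ₑ := by
  have hpi := Real.pi_pos
  set T := ∫⁻ φ in Set.Ioc (-Real.pi) Real.pi,
      ENNReal.ofReal r * ‖fderiv ℝ v (cpt 0 r φ)‖ₑ with hT
  have e1 : v (cpt 0 r θ) - cmean v 0 r = cmean (fun y => v (cpt 0 r θ) - v y) 0 r := by
    unfold cmean
    rw [intervalIntegral.integral_sub]
    · simp; field_simp; ring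
    · simp
    · exact (hv.continuous.comp (cpt_cont' 0 r)).intervalIntegrable _ _
  have hd : ∀ t, HasDerivAt (fun t => v (cpt 0 r t))
      (fderiv ℝ v (cpt 0 r t) (r * (Complex.I * Complex.exp (t * Complex.I)))) t := by
    intro t
    exact ((hv.differentiable (by simp)) _).hasFDerivAt.comp_hasDerivAt t (cpt_dθ 0 r t)
  have hb : ∀ t, ‖fderiv ℝ v (cpt 0 r t) (r * (Complex.I * Complex.exp (t * Complex.I)))‖ₑ ≤
      ENNReal.ofReal r * ‖fderiv ℝ v (cpt 0 r t)‖ₑ := by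
    intro t
    refine (ContinuousLinearMap.le_opENorm _ _).trans ?_
    rw [mul_comm]
    gcongr
    rw [← ofReal_norm]
    simp [abs_of_nonneg hr]
  have hci : Continuous fun t => fderiv ℝ v (cpt 0 r t)
      (r * (Complex.I * Complex.exp (t * Complex.I))) :=
    Continuous.clm_apply ((hv.continuous_fderiv (by simp)).comp (cpt_cont' 0 r)) (by fun_prop)
  have key : ∀ a b, a ∈ Set.Ioc (-Real.pi) Real.pi → b ∈ Set.Ioc (-Real.pi) Real.pi →
      a ≤ b → ‖v (cpt 0 r b) - v (cpt 0 r a)‖ₑ ≤ T := by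
    intro a b ha hb' hab
    have := intervalIntegral.integral_eq_sub_of_hasDerivAt (a := a) (b := b)
      (fun t _ => hd t) (hci.intervalIntegrable _ _)
    rw [← this]
    refine (enorm_ii _ _ _ hab).trans ?_
    refine (lintegral_mono_set (Set.Ioc_subset_Ioc ha.1.le hb'.2)).trans ?_
    exact lintegral_mono hb
  rw [e1]
  refine (cmean_enorm _ _ _).trans ?_
  calc _ ≤ ENNReal.ofReal (2 * Real.pi)⁻¹ * ∫⁻ φ in Set.Ioc (-Real.pi) Real.pi, T := by
        refine mul_le_mul_right ?_ _
        refine setLIntegral_mono' measurableSet_Ioc fun φ hφ => ?_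
        rcases le_total φ θ with h | h
        · exact key φ θ hφ hθ h
        · rw [enorm_sub_rev]; exact key θ φ hθ hφ h
    _ = T := by
        rw [setLIntegral_const, Real.volume_Ioc, mul_comm T, ← mul_assoc, ← ENNReal.ofReal_mul
          (by positivity)]
        have : (2 * Real.pi)⁻¹ * (Real.pi - -Real.pi) = 1 := by field_simp; ring
        rw [this]; simp

/-- gradient integral -/
def GI (v : ℂ → ℝ) : ℝ≥0∞ := ∫⁻ y in WW, ‖fderiv ℝ v y‖ₑ

theorem GI_polar (v : ℂ → ℝ) (hv : ContDiff ℝ (⊤ : ℕ∞) v) :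
    ∫⁻ r in Set.Ioc (5/8:ℝ) (5/2), ∫⁻ θ in Set.Ioc (-Real.pi) Real.pi,
      ENNReal.ofReal r * ‖fderiv ℝ v (cpt 0 r θ)‖ₑ = GI v := by
  unfold cpt
  rw [polar_ann 0 (fun y => ‖fderiv ℝ v y‖ₑ) ?_ _ _ (by norm_num)]
  · rfl
  · exact (hv.continuous_fderiv (by simp)).measurable.enorm

theorem mean_diff (v : ℂ → ℝ) (hv : ContDiff ℝ (⊤ : ℕ∞) v) (r s : ℝ) (hr : 5/8 ≤ r)
    (hrs : r ≤ s) (hs : s ≤ 5/2) :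
    ‖cmean v 0 s - cmean v 0 r‖ₑ ≤ GI v := by
  have hpi := Real.pi_pos
  have hc1 : Continuous (cmean1 v 0) := by
    unfold cmean1
    apply continuous_const.mul
    apply intervalIntegral.continuous_parametric_intervalIntegral_of_continuous'
    exact Continuous.clm_apply ((hv.continuous_fderiv (by simp)).comp (cpt_cont 0)) (by fun_prop)
  have := intervalIntegral.integral_eq_sub_of_hasDerivAt (a := r) (b := s)
      (fun t _ => cmean_deriv v hv 0 t) (hc1.intervalIntegrable _ _)
  rw [← this]
  refine (enorm_ii _ _ _ hrs).trans ?_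
  refine (lintegral_mono_set (Set.Ioc_subset_Ioc hr hs)).trans ?_
  rw [← GI_polar v hv]
  refine setLIntegral_mono' measurableSet_Ioc fun t ht => ?_
  have ht0 : 0 < t := by linarith [ht.1]
  unfold cmean1
  rw [enorm_mul]
  rw [lintegral_const_mul' _ _ (by simp)]
  gcongr
  · rw [Real.enorm_of_nonneg (by positivity)]
    apply ENNReal.ofReal_le_ofReal
    rw [inv_le_comm₀ (by positivity) ht0]
    have : t⁻¹ ≤ 8/5 := by
      rw [inv_le_comm₀ ht0 (by norm_num)]; linarith [ht.1]
    linarith [Real.pi_gt_three]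
  · refine (enorm_ii _ _ _ pi2).trans ?_
    refine lintegral_mono fun θ => ?_
    refine (ContinuousLinearMap.le_opENorm _ _).trans ?_
    rw [← ofReal_norm (Complex.exp _)]
    simp

/-- Poincare constant -/
def KP : ℝ≥0∞ := ENNReal.ofReal (5/2) * (ENNReal.ofReal (2 * Real.pi) *
  (1 + ENNReal.ofReal (15/8)))

theorem poincare (v : ℂ → ℝ) (hv : ContDiff ℝ (⊤ : ℕ∞) v) :
    ∫⁻ y in WW, ‖v y - cmean v 0 (3/2)‖ₑ ≤ KP * GI v := by
  have hpi := Real.pi_pos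
  set c := cmean v 0 (3/2)
  have hm : Measurable fun y => ‖v y - c‖ₑ := (hv.continuous.sub continuous_const).measurable.enorm
  have := polar_ann 0 (fun y => ‖v y - c‖ₑ) hm (5/8) (5/2) (by norm_num)
  change _ = ∫⁻ y in WW, ‖v y - c‖ₑ at this
  rw [← this]
  have hb : ∀ r ∈ Set.Ioc (5/8:ℝ) (5/2), ‖cmean v 0 r - c‖ₑ ≤ GI v := by
    intro r hr
    rcases le_total r (3/2) with h | h
    · rw [enorm_sub_rev]
      exact mean_diff v hv r (3/2) hr.1.le h (by norm_num)
    · exact mean_diff v hv (3/2) r (by norm_num) h hr.2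
  calc _ ≤ ∫⁻ r in Set.Ioc (5/8:ℝ) (5/2), ∫⁻ θ in Set.Ioc (-Real.pi) Real.pi,
        ENNReal.ofReal (5/2) * ((∫⁻ φ in Set.Ioc (-Real.pi) Real.pi,
      ENNReal.ofReal r * ‖fderiv ℝ v (cpt 0 r φ)‖ₑ) + GI v) := by
        refine setLIntegral_mono' measurableSet_Ioc fun r hr => ?_
        refine setLIntegral_mono' measurableSet_Ioc fun θ hθ => ?_
        gcongr
        · exact hr.2
        · change ‖v (cpt 0 r θ) - c‖ₑ ≤ _
          have e : v (cpt 0 r θ) - c = (v (cpt 0 r θ) - cmean v 0 r) + (cmean v 0 r - c) := by ring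
          rw [e]
          refine (enorm_add_le _ _).trans ?_
          gcongr
          · exact mean_osc_circle v hv r θ (by linarith [hr.1]) hθ
          · exact hb r hr
    _ = ENNReal.ofReal (5/2) * (ENNReal.ofReal (2 * Real.pi) *
          ((∫⁻ r in Set.Ioc (5/8:ℝ) (5/2), ∫⁻ φ in Set.Ioc (-Real.pi) Real.pi,
      ENNReal.ofReal r * ‖fderiv ℝ v (cpt 0 r φ)‖ₑ) + ENNReal.ofReal (15/8) * GI v)) := by
        simp only [setLIntegral_const, Real.volume_Ioc]
        have e2 : Real.pi - -Real.pi = 2 * Real.pi := by ring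
        rw [e2, lintegral_mul_const' _ _ ENNReal.ofReal_ne_top, lintegral_const_mul' _ _ (by simp),
          lintegral_add_right _ measurable_const, setLIntegral_const, Real.volume_Ioc]
        norm_num
        ring
    _ = _ := by rw [GI_polar v hv]; unfold KP; ring

theorem ptwise (v : ℂ → ℝ) (hv : ContDiff ℝ (⊤ : ℕ∞) v) (x : ℂ) (h1 : 1 ≤ ‖x‖)
    (h2 : ‖x‖ ≤ 2) :
    ‖v x - cmean v 0 (3/2)‖ₑ ≤ 64 * (KP * GI v) + ENNReal.ofReal (2 * Real.pi)⁻¹ * Pot v x := by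
  have hpi := Real.pi_pos
  set c := cmean v 0 (3/2)
  set p := ENNReal.ofReal (2 * Real.pi)⁻¹ * Pot v x
  rw [← tsub_le_iff_right]
  have hm : Measurable fun y => ‖v y - c‖ₑ := (hv.continuous.sub continuous_const).measurable.enorm
  have h3 : ∀ R ∈ Set.Ioc (1/8:ℝ) (1/4), ‖v x - c‖ₑ - p ≤ ENNReal.ofReal (2 * Real.pi)⁻¹ *
      ∫⁻ θ in Set.Ioc (-Real.pi) Real.pi, ‖v (cpt x R θ) - c‖ₑ := by
    intro R hR
    rw [tsub_le_iff_right]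
    have e : v x - c = cmean (fun y => v y - c) x R + (v x - cmean v x R) := by
      unfold cmean
      rw [intervalIntegral.integral_sub]
      · simp; field_simp; ring
      · exact (hv.continuous.comp (cpt_cont' x R)).intervalIntegrable _ _
      · simp
    rw [e]
    refine (enorm_add_le _ _).trans ?_
    gcongr
    · exact cmean_enorm _ _ _
    · rw [enorm_sub_rev]
      exact green_est v hv x h1 h2 R (by linarith [hR.1]) hR.2
  have h4 : ENNReal.ofReal (1/64) * (‖v x - c‖ₑ - p) ≤ KP * GI v := by
    calc _ = ∫⁻ R in Set.Ioc (1/8:ℝ) (1/4), ENNReal.ofReal (1/8) * (‖v x - c‖ₑ - p) := by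
          rw [setLIntegral_const, Real.volume_Ioc, mul_right_comm, ← ENNReal.ofReal_mul (by norm_num)]
          norm_num
      _ ≤ ∫⁻ R in Set.Ioc (1/8:ℝ) (1/4), ∫⁻ θ in Set.Ioc (-Real.pi) Real.pi,
          ENNReal.ofReal R * ‖v (cpt x R θ) - c‖ₑ := by
          refine setLIntegral_mono' measurableSet_Ioc fun R hR => ?_
          rw [lintegral_const_mul' _ _ (by simp)]
          gcongr
          · exact hR.1.le
          · refine (h3 R hR).trans ?_
            refine mul_le_of_le_one_left' ?_
            rw [ENNReal.ofReal_le_one]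
            apply inv_le_one_of_one_le₀
            linarith [Real.pi_gt_three]
      _ = ∫⁻ y in {y | 1/8 < ‖y - x‖ ∧ ‖y - x‖ ≤ 1/4}, ‖v y - c‖ₑ := by
          unfold cpt
          exact polar_ann x (fun y => ‖v y - c‖ₑ) hm (1/8) (1/4) (by norm_num)
      _ ≤ ∫⁻ y in WW, ‖v y - c‖ₑ := lintegral_mono_set (sub_WW x h1 h2 _ _ le_rfl)
      _ ≤ _ := poincare v hv
  calc ‖v x - c‖ₑ - p = 64 * (ENNReal.ofReal (1/64) * (‖v x - c‖ₑ - p)) := by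
        rw [← mul_assoc]
        have : (64:ℝ≥0∞) = ENNReal.ofReal 64 := by norm_num
        rw [this, ← ENNReal.ofReal_mul (by norm_num)]; norm_num
    _ ≤ _ := by gcongr

/-- total curvature on working annulus -/
def LI (v : ℂ → ℝ) : ℝ≥0∞ := ∫⁻ y in WW, ‖lap v y‖ₑ

theorem jensen_aux {α : Type*} [MeasurableSpace α] (μ : Measure α) (hμ : μ Set.univ ≤ 1)
    (k : α → ℝ) (hk : Measurable k) (hk0 : ∀ x, 0 ≤ k x)
    (ha : ∫⁻ x, ENNReal.ofReal (k x) ∂μ ≠ ⊤) :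
    ENNReal.ofReal (Real.exp (∫⁻ x, ENNReal.ofReal (k x) ∂μ).toReal) ≤
      1 + ∫⁻ x, ENNReal.ofReal (Real.exp (k x)) ∂μ := by
  set A := ∫⁻ x, ENNReal.ofReal (k x) ∂μ with hA
  set a := A.toReal
  have ha0 : 0 ≤ a := ENNReal.toReal_nonneg
  set X := ∫⁻ x, ENNReal.ofReal (Real.exp (k x)) ∂μ with hX
  by_cases hXt : X = ⊤
  · simp [hXt]
  set m := (μ Set.univ).toReal
  have hmt : μ Set.univ ≠ ⊤ := ne_top_of_le_ne_top ENNReal.one_ne_top hμ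
  have hm1 : m ≤ 1 := by
    have := ENNReal.toReal_mono ENNReal.one_ne_top hμ
    simpa using this
  have hm0 : 0 ≤ m := ENNReal.toReal_nonneg
  have key : ENNReal.ofReal (Real.exp a) * (μ Set.univ + A) ≤
      X + ENNReal.ofReal (a * Real.exp a) * μ Set.univ := by
    have h1 : ∫⁻ x, ENNReal.ofReal (Real.exp a) * (1 + ENNReal.ofReal (k x)) ∂μ ≤
        ∫⁻ x, (ENNReal.ofReal (Real.exp (k x)) + ENNReal.ofReal (a * Real.exp a)) ∂μ := by
      refine lintegral_mono fun x => ?_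
      rw [← ENNReal.ofReal_one, ← ENNReal.ofReal_add zero_le_one (hk0 x),
        ← ENNReal.ofReal_mul (Real.exp_pos _).le,
        ← ENNReal.ofReal_add (Real.exp_pos _).le (by positivity)]
      apply ENNReal.ofReal_le_ofReal
      have h2 : Real.exp (k x) = Real.exp a * Real.exp (k x - a) := by
        rw [← Real.exp_add]; ring_nf
      have h3 := Real.add_one_le_exp (k x - a)
      have h4 := mul_le_mul_of_nonneg_left h3 (Real.exp_pos a).le
      rw [h2]; linarith
    rw [lintegral_const_mul' _ _ (by simp), lintegral_add_right _ (by fun_prop),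
      lintegral_add_right _ measurable_const] at h1
    simpa using h1
  have hr : Real.exp a * (m + a) ≤ X.toReal + a * Real.exp a * m := by
    have h5 := ENNReal.toReal_mono (by finiteness) key
    rw [ENNReal.toReal_mul, ENNReal.toReal_add hmt ha, ENNReal.toReal_add hXt (by finiteness),
      ENNReal.toReal_mul, ENNReal.toReal_ofReal (Real.exp_pos _).le,
      ENNReal.toReal_ofReal (by positivity)] at h5
    exact h5
  have h6 : Real.exp a * (1 - a) ≤ 1 := by
    have := Real.add_one_le_exp (-a)
    calc Real.exp a * (1 - a) ≤ Real.exp a * Real.exp (-a) := by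
          gcongr; linarith
      _ = 1 := by rw [← Real.exp_add]; simp
  have h7 : Real.exp a ≤ 1 + X.toReal := by
    nlinarith [mul_le_mul_of_nonneg_right h6 (sub_nonneg.2 hm1)]
  calc _ ≤ ENNReal.ofReal (1 + X.toReal) := ENNReal.ofReal_le_ofReal h7
    _ = _ := by
      rw [ENNReal.ofReal_add zero_le_one ENNReal.toReal_nonneg, ENNReal.ofReal_toReal hXt,
        ENNReal.ofReal_one]

theorem kk_nonneg (s : ℝ) : 0 ≤ kk s := le_max_left _ _

/-- exponential potential -/
def XX (v : ℂ → ℝ) (x : ℂ) : ℝ≥0∞ :=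
  ∫⁻ y in WW, ENNReal.ofReal (Real.exp (kk ‖y - x‖)) * ‖lap v y‖ₑ

theorem pot_le_XX (v : ℂ → ℝ) (x : ℂ) : Pot v x ≤ XX v x := by
  unfold Pot XX
  refine lintegral_mono fun y => ?_
  refine mul_le_mul_left (ENNReal.ofReal_le_ofReal ?_) _
  linarith [Real.add_one_le_exp (kk ‖y - x‖)]

theorem jensen_pot (v : ℂ → ℝ) (hv : ContDiff ℝ (⊤ : ℕ∞) v) (hL : LI v ≤ 1) (x : ℂ)
    (ha : Pot v x ≠ ⊤) :
    ENNReal.ofReal (Real.exp (Pot v x).toReal) ≤ 1 + XX v x := by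
  have hlm : Measurable fun y => ‖lap v y‖ₑ := (lap_cont v hv).measurable.enorm
  have hkm : Measurable fun y : ℂ => kk ‖y - x‖ := kk_meas.comp (by fun_prop)
  have e1 : Pot v x = ∫⁻ y, ENNReal.ofReal (kk ‖y - x‖)
      ∂((volume.restrict WW).withDensity fun y => ‖lap v y‖ₑ) := by
    rw [lintegral_withDensity_eq_lintegral_mul _ hlm (by fun_prop)]
    unfold Pot
    refine lintegral_congr fun y => ?_
    simp [mul_comm]
  have e2 : XX v x = ∫⁻ y, ENNReal.ofReal (Real.exp (kk ‖y - x‖))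
      ∂((volume.restrict WW).withDensity fun y => ‖lap v y‖ₑ) := by
    rw [lintegral_withDensity_eq_lintegral_mul _ hlm (by fun_prop)]
    unfold XX
    refine lintegral_congr fun y => ?_
    simp [mul_comm]
  rw [e2]
  rw [e1] at ha ⊢
  refine jensen_aux _ ?_ _ hkm (fun y => kk_nonneg _) ha
  rw [withDensity_apply _ MeasurableSet.univ, Measure.restrict_univ]
  exact hL

theorem exp3_le (v : ℂ → ℝ) (hv : ContDiff ℝ (⊤ : ℕ∞) v) (hL : LI v ≤ 1) (C0 : ℝ) (hC0 : 0 ≤ C0)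
    (hG : 64 * (KP * GI v) ≤ ENNReal.ofReal C0) (x : ℂ) (h1 : 1 ≤ ‖x‖) (h2 : ‖x‖ ≤ 2) :
    ENNReal.ofReal (Real.exp (3 * (v x - cmean v 0 (3/2)))) ≤
      ENNReal.ofReal (Real.exp (3 * C0)) * (1 + XX v x) := by
  have hpi := Real.pi_gt_three
  by_cases ha : Pot v x = ⊤
  · have : XX v x = ⊤ := top_le_iff.1 (ha ▸ pot_le_XX v x)
    rw [this, add_top, ENNReal.mul_top (by simp [Real.exp_pos])]
    exact le_top
  have h3 := (ptwise v hv x h1 h2).trans (add_le_add_left hG _)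
  have h4 : |v x - cmean v 0 (3/2)| ≤ C0 + (2 * Real.pi)⁻¹ * (Pot v x).toReal := by
    have := ENNReal.toReal_mono (by finiteness) h3
    rw [toReal_enorm, ENNReal.toReal_add (by finiteness) (by finiteness), ENNReal.toReal_mul,
      ENNReal.toReal_ofReal hC0, ENNReal.toReal_ofReal (by positivity)] at this
    exact this
  have h5 : (2 * Real.pi)⁻¹ ≤ 1/3 := by
    rw [inv_le_comm₀ (by positivity) (by norm_num)]; linarith
  have h6 : 0 ≤ (Pot v x).toReal := ENNReal.toReal_nonneg
  have h7 : 3 * (v x - cmean v 0 (3/2)) ≤ 3 * C0 + (Pot v x).toReal := by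
    nlinarith [le_abs_self (v x - cmean v 0 (3/2))]
  calc _ ≤ ENNReal.ofReal (Real.exp (3 * C0) * Real.exp (Pot v x).toReal) := by
        rw [← Real.exp_add]
        exact ENNReal.ofReal_le_ofReal (Real.exp_le_exp.2 h7)
    _ = ENNReal.ofReal (Real.exp (3 * C0)) * ENNReal.ofReal (Real.exp (Pot v x).toReal) :=
        ENNReal.ofReal_mul (Real.exp_pos _).le
    _ ≤ _ := by gcongr; exact jensen_pot v hv hL x ha

/-- closed annulus -/
def AA : Set ℂ := {y | 1 < ‖y - 0‖ ∧ ‖y - 0‖ ≤ 2}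

theorem AA_meas : MeasurableSet AA := by
  apply MeasurableSet.inter
  · exact measurableSet_lt measurable_const (by fun_prop : Measurable fun y : ℂ => ‖y - 0‖)
  · exact measurableSet_le (by fun_prop : Measurable fun y : ℂ => ‖y - 0‖) measurable_const

theorem AA_fin : volume AA ≠ ⊤ := by
  refine ne_top_of_le_ne_top (b := volume (closedBall (0:ℂ) 2)) ?_ (measure_mono ?_)
  · exact measure_closedBall_lt_top.ne
  · intro y hy; simpa using hy.2

def J2 : ℝ≥0∞ := ∫⁻ z in {z : ℂ | 0 < ‖z - 0‖ ∧ ‖z - 0‖ ≤ 5}, ENNReal.ofReal (1 / ‖z‖)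

theorem J2_fin : J2 ≠ ⊤ := by
  unfold J2
  rw [← polar_ann 0 (fun z => ENNReal.ofReal (1 / ‖z‖)) (by fun_prop) 0 5 le_rfl]
  have : ∫⁻ r in Set.Ioc (0:ℝ) 5, ∫⁻ θ in Set.Ioc (-Real.pi) Real.pi,
      ENNReal.ofReal r * ENNReal.ofReal (1 / ‖(0:ℂ) + r * Complex.exp (θ * Complex.I)‖)
      ≤ ∫⁻ r in Set.Ioc (0:ℝ) 5, ∫⁻ θ in Set.Ioc (-Real.pi) Real.pi, 1 := by
    refine setLIntegral_mono' measurableSet_Ioc fun r hr => ?_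
    refine lintegral_mono fun θ => ?_
    rw [← ENNReal.ofReal_mul hr.1.le]
    have := hr.1
    simp [abs_of_pos this, this.ne']
  refine ne_top_of_le_ne_top ?_ this
  simp
  finiteness

theorem exp_kk_le (s : ℝ) (hs : 0 < s) : Real.exp (kk s) ≤ 1 + 1 / s := by
  unfold kk
  rcases le_total 0 (-Real.log (4 * s)) with h | h
  · rw [max_eq_right h, Real.exp_neg, Real.exp_log (by positivity)]
    have : (4 * s)⁻¹ ≤ 1 / s := by
      rw [one_div]; apply inv_anti₀ hs; linarith
    linarith
  · rw [max_eq_left h]; simp; positivity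

theorem XX_int (v : ℂ → ℝ) (hv : ContDiff ℝ (⊤ : ℕ∞) v) :
    ∫⁻ x in AA, XX v x ≤ LI v * (volume AA + J2) := by
  have hlm : Measurable fun y => ‖lap v y‖ₑ := (lap_cont v hv).measurable.enorm
  have hkm := kk_meas
  unfold XX
  rw [lintegral_lintegral_swap]
  · unfold LI
    rw [← lintegral_mul_const'' _ hlm.aemeasurable]
    refine setLIntegral_mono' WW_meas fun y hy => ?_
    rw [lintegral_mul_const _ (by fun_prop), mul_comm]
    refine mul_le_mul_right ?_ _
    set S : Set ℂ := {z : ℂ | 0 < ‖z - 0‖ ∧ ‖z - 0‖ ≤ 5} with hS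
    have hSm : MeasurableSet S := by
      apply MeasurableSet.inter
      · exact measurableSet_lt measurable_const (by fun_prop : Measurable fun y : ℂ => ‖y - 0‖)
      · exact measurableSet_le (by fun_prop : Measurable fun y : ℂ => ‖y - 0‖) measurable_const
    calc _ ≤ ∫⁻ x in AA, (1 + S.indicator (fun z => ENNReal.ofReal (1 / ‖z‖)) (x - y)) := by
          refine setLIntegral_mono' AA_meas fun x hx => ?_
          by_cases hxy : x = y
          · subst hxy
            simp [kk]
          · have hpos : 0 < ‖x - y‖ := norm_pos_iff.2 (sub_ne_zero.2 hxy)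
            have hmem : x - y ∈ S := by
              refine ⟨by simpa using hpos, ?_⟩
              rw [sub_zero]
              have h1 := hx.2
              have h2 := hy.2
              rw [sub_zero] at h1 h2
              have := norm_sub_le x y
              linarith
            rw [Set.indicator_of_mem hmem, ← ENNReal.ofReal_one, ← ENNReal.ofReal_add zero_le_one
              (by positivity), norm_sub_rev y x]
            exact ENNReal.ofReal_le_ofReal (exp_kk_le _ hpos)
      _ = volume AA + ∫⁻ x in AA, S.indicator (fun z => ENNReal.ofReal (1 / ‖z‖)) (x - y) := by
          rw [lintegral_add_left measurable_const]; simp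
      _ ≤ volume AA + ∫⁻ x, S.indicator (fun z => ENNReal.ofReal (1 / ‖z‖)) (x - y) := by
          gcongr; exact Measure.restrict_le_self
      _ = _ := by
          rw [lintegral_sub_right_eq_self (S.indicator fun z => ENNReal.ofReal (1 / ‖z‖)) y,
            lintegral_indicator hSm]
          rfl
  · apply Measurable.aemeasurable
    simp only [Function.uncurry_def]
    exact Measurable.fun_mul (by fun_prop) (hlm.comp measurable_snd)

theorem exp3_int (v : ℂ → ℝ) (hv : ContDiff ℝ (⊤ : ℕ∞) v) (hL : LI v ≤ 1) (C0 : ℝ) (hC0 : 0 ≤ C0)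
    (hG : 64 * (KP * GI v) ≤ ENNReal.ofReal C0) :
    ∫⁻ x in AA, ENNReal.ofReal (Real.exp (3 * (v x - cmean v 0 (3/2)))) ≤
      ENNReal.ofReal (Real.exp (3 * C0)) * (volume AA + (volume AA + J2)) := by
  calc _ ≤ ∫⁻ x in AA, ENNReal.ofReal (Real.exp (3 * C0)) * (1 + XX v x) := by
        refine setLIntegral_mono' AA_meas fun x hx => ?_
        have h1 := hx.1
        have h2 := hx.2
        rw [sub_zero] at h1 h2
        exact exp3_le v hv hL C0 hC0 hG x h1.le h2
    _ = ENNReal.ofReal (Real.exp (3 * C0)) * (volume AA + ∫⁻ x in AA, XX v x) := by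
        rw [lintegral_const_mul' _ _ (by simp), lintegral_add_left measurable_const]
        simp
    _ ≤ _ := by
        gcongr
        refine (XX_int v hv).trans ?_
        exact mul_le_of_le_one_left' hL

/-- log kernel, infinite at zero -/
def Kq (s : ℝ) : ℝ≥0∞ := if s = 0 then ⊤ else ENNReal.ofReal (kk s)

theorem Kq_meas : Measurable Kq := by
  unfold Kq
  exact Measurable.ite (measurableSet_singleton 0) measurable_const
    (ENNReal.measurable_ofReal.comp kk_meas)

def LL : ℝ≥0∞ := ∫⁻ s, Kq s

theorem LL_fin : LL ≠ ⊤ := by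
  have h1 : LL = ∫⁻ s, ENNReal.ofReal (kk s) := by
    unfold LL
    refine lintegral_congr_ae ?_
    have : ∀ᵐ s : ℝ, s ≠ 0 := by simp [ae_iff]
    filter_upwards [this] with s hs
    simp [Kq, hs]
  rw [h1]
  have hi := (intervalIntegral.intervalIntegrable_log' (a := -1) (b := 1)).1.2
  rw [hasFiniteIntegral_iff_enorm] at hi
  refine ne_top_of_le_ne_top hi.ne ?_
  rw [← lintegral_indicator measurableSet_Ioc]
  refine lintegral_mono fun s => ?_
  by_cases hs0 : s = 0
  · subst hs0; simp [kk]
  have hlog : Real.log (4 * s) = Real.log 4 + Real.log s :=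
    Real.log_mul (by norm_num) hs0
  have hl4 : 0 < Real.log 4 := Real.log_pos (by norm_num)
  by_cases hs : s ∈ Set.Ioc (-1:ℝ) 1
  · rw [Set.indicator_of_mem hs, ← ofReal_norm]
    apply ENNReal.ofReal_le_ofReal
    unfold kk
    rw [hlog]
    apply max_le (norm_nonneg _)
    rw [Real.norm_eq_abs]
    linarith [neg_abs_le (Real.log s)]
  · rw [Set.indicator_of_notMem hs]
    have h2 : 1 ≤ |s| := by
      by_contra h
      push Not at h
      rw [abs_lt] at h
      exact hs ⟨h.1, h.2.le⟩
    have h3 : 0 ≤ Real.log s := by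
      rw [← Real.log_abs]; exact Real.log_nonneg h2
    have : kk s = 0 := by
      unfold kk; rw [hlog]; apply max_eq_left; linarith
    simp [this]

/-- radial potential -/
def QQ (v : ℂ → ℝ) (r : ℝ) : ℝ≥0∞ := ∫⁻ y in WW, Kq (‖y‖ - r) * ‖lap v y‖ₑ

theorem kk_abs (s : ℝ) : kk |s| = kk s := by
  unfold kk
  have : 4 * |s| = |4 * s| := by rw [abs_mul]; norm_num
  rw [this, Real.log_abs]

theorem pot_le_QQ (v : ℂ → ℝ) (x : ℂ) : Pot v x ≤ QQ v ‖x‖ := by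
  unfold Pot QQ
  refine lintegral_mono fun y => ?_
  refine mul_le_mul_left ?_ _
  unfold Kq
  split_ifs with h
  · exact le_top
  · apply ENNReal.ofReal_le_ofReal
    rw [← kk_abs (‖y‖ - ‖x‖)]
    unfold kk
    have h1 := abs_norm_sub_norm_le y x
    have h2 : 0 < |‖y‖ - ‖x‖| := abs_pos.2 h
    apply max_le_max le_rfl
    apply neg_le_neg
    apply Real.log_le_log (by positivity)
    linarith

theorem QQ_meas (v : ℂ → ℝ) (hv : ContDiff ℝ (⊤ : ℕ∞) v) : Measurable (QQ v) := by
  have hlm : Measurable fun y => ‖lap v y‖ₑ := (lap_cont v hv).measurable.enorm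
  unfold QQ
  apply Measurable.lintegral_prod_right'
    (f := fun p : ℝ × ℂ => Kq (‖p.2‖ - p.1) * ‖lap v p.2‖ₑ)
  exact Measurable.fun_mul (Kq_meas.comp (by fun_prop)) (hlm.comp measurable_snd)

theorem QQ_int (v : ℂ → ℝ) (hv : ContDiff ℝ (⊤ : ℕ∞) v) :
    ∫⁻ r, QQ v r ≤ LI v * LL := by
  have hlm : Measurable fun y => ‖lap v y‖ₑ := (lap_cont v hv).measurable.enorm
  have hkm := Kq_meas
  unfold QQ
  rw [lintegral_lintegral_swap]
  · unfold LI
    rw [← lintegral_mul_const'' _ hlm.aemeasurable]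
    refine setLIntegral_mono' WW_meas fun y hy => ?_
    rw [lintegral_mul_const _ (by fun_prop), mul_comm]
    refine mul_le_mul_right ?_ _
    rw [lintegral_sub_left_eq_self Kq ‖y‖]
    exact le_rfl
  · apply Measurable.aemeasurable
    simp only [Function.uncurry_def]
    exact Measurable.fun_mul (by fun_prop) (hlm.comp measurable_snd)

theorem good_radii (v : ℂ → ℝ) (hv : ContDiff ℝ (⊤ : ℕ∞) v) (hL : LI v * LL ≤ ENNReal.ofReal (1/2))
    (C0 : ℝ) (hC0 : 0 ≤ C0) (hG : 64 * (KP * GI v) ≤ ENNReal.ofReal C0) :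
    ∃ E : Set ℝ, MeasurableSet E ∧ E ⊆ Set.Ioc 1 2 ∧ ENNReal.ofReal (1/2) ≤ volume E ∧
      ∀ x : ℂ, ‖x‖ ∈ E → cmean v 0 (3/2) - (C0 + 1) ≤ v x := by
  have hpi := Real.pi_gt_three
  have hQ := QQ_meas v hv
  have hB : MeasurableSet {r | 1 ≤ QQ v r} := measurableSet_le measurable_const hQ
  refine ⟨Set.Ioc 1 2 \ {r | 1 ≤ QQ v r}, measurableSet_Ioc.diff hB, Set.sdiff_subset, ?_, ?_⟩
  · have h1 : volume {r | 1 ≤ QQ v r} ≤ ENNReal.ofReal (1/2) := by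
      have := mul_meas_ge_le_lintegral (μ := volume) hQ 1
      rw [one_mul] at this
      exact this.trans ((QQ_int v hv).trans hL)
    have h2 := le_measure_sdiff (μ := volume) (s₁ := Set.Ioc (1:ℝ) 2) (s₂ := {r | 1 ≤ QQ v r})
    refine le_trans ?_ h2
    rw [Real.volume_Ioc]
    calc ENNReal.ofReal (1/2) = ENNReal.ofReal (2 - 1) - ENNReal.ofReal (1/2) := by
          rw [← ENNReal.ofReal_sub _ (by norm_num)]; norm_num
      _ ≤ _ := tsub_le_tsub_left h1 _
  · intro x hx
    have h1 : QQ v ‖x‖ < 1 := not_le.1 hx.2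
    have h2 : Pot v x ≤ 1 := (pot_le_QQ v x).trans h1.le
    have h3 := (ptwise v hv x hx.1.1.le hx.1.2).trans (add_le_add_left hG _)
    have h4 : ‖v x - cmean v 0 (3/2)‖ₑ ≤ ENNReal.ofReal (C0 + 1) := by
      refine h3.trans ?_
      rw [ENNReal.ofReal_add hC0 zero_le_one]
      gcongr
      rw [ENNReal.ofReal_one]
      refine mul_le_one' ?_ h2
      rw [ENNReal.ofReal_le_one]
      apply inv_le_one_of_one_le₀
      linarith
    rw [← ofReal_norm, ENNReal.ofReal_le_ofReal_iff (by positivity), Real.norm_eq_abs] at h4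
    linarith [neg_abs_le (v x - cmean v 0 (3/2))]

theorem cutoff_ex (u : ℂ → ℝ)
    (hu : ContDiffOn ℝ (⊤ : ℕ∞) u (ball (0:ℂ) 4 \ closedBall (0:ℂ) (1/4))) :
    ∃ v : ℂ → ℝ, ContDiff ℝ (⊤ : ℕ∞) v ∧ ∀ y, 1/2 < ‖y‖ → ‖y‖ < 3 → v y = u y := by
  set χ : ℂ → ℝ := fun y => Real.smoothTransition (8 * ‖y‖^2 - 1) *
    Real.smoothTransition ((15 - ‖y‖^2)/6) with hχ
  have hχs : ContDiff ℝ (⊤ : ℕ∞) χ := by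
    have h2 : ContDiff ℝ (⊤ : ℕ∞) (fun y : ℂ => ‖y‖^2) := contDiff_norm_sq ℝ
    apply ContDiff.mul
    · exact Real.smoothTransition.contDiff.comp ((contDiff_const.mul h2).sub contDiff_const)
    · exact Real.smoothTransition.contDiff.comp ((contDiff_const.sub h2).div_const _)
  refine ⟨fun y => χ y * u y, ?_, ?_⟩
  · rw [contDiff_iff_contDiffAt]
    intro y
    have hn : Continuous (fun y : ℂ => ‖y‖^2) := by fun_prop
    by_cases hy : y ∈ ball (0:ℂ) 4 \ closedBall (0:ℂ) (1/4)
    · have ho : IsOpen (ball (0:ℂ) 4 \ closedBall (0:ℂ) (1/4)) :=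
        isOpen_ball.sdiff isClosed_closedBall
      exact hχs.contDiffAt.mul (hu.contDiffAt (ho.mem_nhds hy))
    · have hz : (fun y => χ y * u y) =ᶠ[𝓝 y] fun _ => 0 := by
        have hc : ‖y‖^2 < 1/8 ∨ 15 < ‖y‖^2 := by
          simp only [Set.mem_sdiff, mem_ball_zero_iff, mem_closedBall_zero_iff, not_and, not_not] at hy
          by_cases h : ‖y‖ < 4
          · left; have := hy h; have := norm_nonneg y; nlinarith
          · right; push Not at h; nlinarith
        rcases hc with hc | hc
        · filter_upwards [hn.continuousAt.eventually (gt_mem_nhds hc)] with z hz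
          simp only [hχ]
          rw [Real.smoothTransition.zero_of_nonpos (by linarith : 8 * ‖z‖^2 - 1 ≤ 0)]; simp
        · filter_upwards [hn.continuousAt.eventually (lt_mem_nhds hc)] with z hz
          simp only [hχ]
          rw [Real.smoothTransition.zero_of_nonpos (by linarith : (15 - ‖z‖^2)/6 ≤ 0)]; simp
      exact contDiffAt_const.congr_of_eventuallyEq hz
  · intro y h1 h2
    simp only [hχ]
    rw [Real.smoothTransition.one_of_one_le (by nlinarith),
      Real.smoothTransition.one_of_one_le (by nlinarith)]
    simp

theorem WW_sub : WW ⊆ ball (0:ℂ) 4 \ closedBall (0:ℂ) (1/4) := by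
  intro y hy
  simp only [WW, sub_zero, Set.mem_ofPred_eq] at hy
  simp only [Set.mem_sdiff, mem_ball_zero_iff, mem_closedBall_zero_iff, not_le]
  constructor <;> linarith [hy.1, hy.2]

theorem grad_bd (Λ : ℝ) (hΛ : 0 < Λ) : ∃ M : ℝ≥0∞, M ≠ ⊤ ∧ ∀ u : ℂ → ℝ,
    wL2Bound (fun x => ‖fderiv ℝ u x‖) (ball (0:ℂ) 4 \ closedBall (0:ℂ) (1/4)) Λ →
    GI u ≤ M := by
  refine ⟨volume (ball (0:ℂ) 4) * volume (Set.Ioc (0:ℝ) 1) +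
    ∫⁻ t in Set.Ioi (1:ℝ), ENNReal.ofReal (Λ^2 * t ^ (-2:ℝ)), ?_, ?_⟩
  · refine ENNReal.add_ne_top.2 ⟨ENNReal.mul_ne_top measure_ball_lt_top.ne (by simp), ?_⟩
    have := (integrableOn_Ioi_rpow_of_lt (by norm_num : (-2:ℝ) < -1) one_pos).const_mul (Λ^2)
    exact (Integrable.lintegral_lt_top this).ne
  · intro u h
    unfold GI
    have hm : Measurable fun y => ‖fderiv ℝ u y‖ := (measurable_fderiv ℝ u).norm
    have e : ∫⁻ y in WW, ‖fderiv ℝ u y‖ₑ = ∫⁻ y in WW, ENNReal.ofReal (‖fderiv ℝ u y‖) := by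
      simp only [ofReal_norm]
    rw [e, lintegral_eq_lintegral_meas_lt _ (Eventually.of_forall fun _ => norm_nonneg _)
      hm.aemeasurable]
    rw [← Set.Ioc_union_Ioi_eq_Ioi (zero_le_one (α := ℝ))]
    refine (lintegral_union_le _ _ _).trans ?_
    have key : ∀ t, (volume.restrict WW) {a | t < ‖fderiv ℝ u a‖} ≤
        volume {x ∈ ball (0:ℂ) 4 \ closedBall (0:ℂ) (1/4) | t < |‖fderiv ℝ u x‖|} := by
      intro t
      rw [Measure.restrict_apply (measurableSet_lt measurable_const hm)]
      apply measure_mono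
      rintro x ⟨h1, h2⟩
      exact ⟨WW_sub h2, by simpa using h1⟩
    have hfin : ∀ t, volume {x ∈ ball (0:ℂ) 4 \ closedBall (0:ℂ) (1/4) | t < |‖fderiv ℝ u x‖|}
        ≤ volume (ball (0:ℂ) 4) := fun t => measure_mono fun x hx => hx.1.1
    gcongr ?_ + ?_
    · rw [← setLIntegral_const]
      exact lintegral_mono fun t => (key t).trans (hfin t)
    · refine setLIntegral_mono (by fun_prop) fun t ht => (key t).trans ?_
      have ht : 1 < t := ht
      have := h t (by linarith)
      set V := volume {x ∈ ball (0:ℂ) 4 \ closedBall (0:ℂ) (1/4) | t < |‖fderiv ℝ u x‖|} with hV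
      have hVf : V ≠ ⊤ := ((hfin t).trans_lt measure_ball_lt_top).ne
      rw [← ENNReal.ofReal_toReal hVf]
      apply ENNReal.ofReal_le_ofReal
      rw [← Real.sqrt_eq_rpow] at this
      have h0 : 0 ≤ V.toReal := ENNReal.toReal_nonneg
      have h2 := Real.sq_sqrt h0
      rw [Real.rpow_neg (by linarith), ← div_eq_mul_inv, le_div_iff₀ (by positivity)]
      have h3 : (t * √V.toReal)^2 ≤ Λ^2 := pow_le_pow_left₀ (by positivity) this 2
      rw [mul_pow, h2] at h3
      norm_num
      linarith

theorem eq_nhds {u v : ℂ → ℝ} (h : ∀ y, 1/2 < ‖y‖ → ‖y‖ < 3 → v y = u y) {y : ℂ} (hy : y ∈ WW) :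
    v =ᶠ[𝓝 y] u := by
  simp only [WW, sub_zero, Set.mem_ofPred_eq] at hy
  have hn : Continuous (fun y : ℂ => ‖y‖) := by fun_prop
  filter_upwards [hn.continuousAt.eventually (lt_mem_nhds (by linarith [hy.1] : 1/2 < ‖y‖)),
    hn.continuousAt.eventually (gt_mem_nhds (by linarith [hy.2] : ‖y‖ < 3))] with z h1 h2
  exact h z h1 h2

theorem GI_eq {u v : ℂ → ℝ} (h : ∀ y, 1/2 < ‖y‖ → ‖y‖ < 3 → v y = u y) : GI v = GI u := by
  unfold GI
  refine setLIntegral_congr_fun WW_meas fun y hy => ?_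
  simp only [(eq_nhds h hy).fderiv_eq]

theorem LI_le {u v : ℂ → ℝ} (h : ∀ y, 1/2 < ‖y‖ → ‖y‖ < 3 → v y = u y) :
    LI v ≤ curvIntE u (ball (0:ℂ) 4 \ closedBall (0:ℂ) (1/2)) := by
  unfold LI curvIntE
  have e : ∫⁻ y in WW, ‖lap v y‖ₑ =
      ∫⁻ y in WW, ENNReal.ofReal (|gauss u y| * Real.exp (2 * u y)) := by
    refine setLIntegral_congr_fun WW_meas fun y hy => ?_
    have : lap v y = lap u y := by
      unfold lap
      rw [((eq_nhds h hy).iteratedFDeriv ℝ 2).self_of_nhds]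
    simp only [this]
    rw [← ofReal_norm]
    congr 1
    unfold gauss
    rw [abs_mul, abs_neg, abs_of_pos (Real.exp_pos _), mul_right_comm, ← Real.exp_add]
    simp
  rw [e]
  refine lintegral_mono_set fun y hy => ?_
  simp only [WW, sub_zero, Set.mem_ofPred_eq] at hy
  simp only [Set.mem_sdiff, mem_ball_zero_iff, mem_closedBall_zero_iff, not_le]
  constructor <;> linarith [hy.1, hy.2]

theorem cpt_per (v : ℂ → ℝ) (x : ℂ) (r : ℝ) :
    Function.Periodic (fun θ : ℝ => v (cpt x r θ)) (2 * Real.pi) := by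
  intro θ
  simp only [cpt]
  have : Complex.exp (((θ + 2 * Real.pi : ℝ) : ℂ) * Complex.I) =
      Complex.exp ((θ : ℂ) * Complex.I) := by
    push_cast
    rw [add_mul, Complex.exp_periodic]
  rw [this]

theorem circMean_eq {u v : ℂ → ℝ} (h : ∀ y, 1/2 < ‖y‖ → ‖y‖ < 3 → v y = u y) :
    circMean u (3/2) = cmean v 0 (3/2) := by
  unfold circMean cmean
  congr 1
  have h1 := (cpt_per v 0 (3/2)).intervalIntegral_add_eq (-Real.pi) 0
  rw [show -Real.pi + 2 * Real.pi = Real.pi by ring, zero_add] at h1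
  rw [h1]
  refine intervalIntegral.integral_congr fun θ _ => ?_
  simp only [cpt, zero_add]
  rw [h]
  · rw [norm_mul, Complex.norm_exp_ofReal_mul_I, Complex.norm_real]; norm_num
  · rw [norm_mul, Complex.norm_exp_ofReal_mul_I, Complex.norm_real]; norm_num

theorem confLen_lower (u : ℂ → ℝ) (S : Set ℂ) (hu : ContinuousOn u S) (E : Set ℝ)
    (hE : MeasurableSet E) (hE2 : E ⊆ Set.Ioc 1 2) (hvol : ENNReal.ofReal (1/2) ≤ volume E)
    (m : ℝ) (hm : ∀ x : ℂ, ‖x‖ ∈ E → m ≤ u x) (x y : ℂ) (hx : ‖x‖ = 1) (hy : ‖y‖ = 2)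
    (γ : ℝ → ℂ) (hγ : γ ∈ PathsIn S x y) : 1/2 * Real.exp m ≤ confLen u γ := by
  obtain ⟨h0, h1, hS, hC⟩ := hγ
  have hγc : Continuous γ := hC.continuous
  have hγd : ∀ t, HasDerivAt γ (deriv γ t) t := fun t =>
    (hC.differentiable one_ne_zero t).hasDerivAt
  have hγ' : Continuous (deriv γ) := hC.continuous_deriv le_rfl
  set ρ : ℝ → ℝ := fun t => ‖γ t‖ with hρ
  have hρc : Continuous ρ := hγc.norm
  set T : Set ℝ := Set.Ioc 0 1 ∩ ρ ⁻¹' E with hT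
  have hTm : MeasurableSet T := measurableSet_Ioc.inter (hρc.measurable hE)
  have hsub : E ⊆ ρ '' T := by
    intro e he
    have h12 := hE2 he
    have := intermediate_value_Icc (zero_le_one (α := ℝ)) hρc.continuousOn
    simp only [hρ, h0, h1, hx, hy] at this
    obtain ⟨t, ht, hte⟩ := this ⟨h12.1.le, h12.2⟩
    refine ⟨t, ⟨⟨lt_of_le_of_ne ht.1 ?_, ht.2⟩, by simpa [hρ, hte] using he⟩, hte⟩
    rintro rfl
    simp only [h0, hx] at hte
    linarith [h12.1]
  have hdρ : ∀ t ∈ T, DifferentiableAt ℝ ρ t := by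
    intro t ht
    have h2 : (1:ℝ) < ρ t := (hE2 ht.2).1
    have hne : γ t ≠ 0 := by intro h; simp only [hρ, h, norm_zero] at h2; linarith
    exact (hγd t).differentiableAt.norm ℝ hne
  have hρ' : ∀ t ∈ T, |deriv ρ t| ≤ ‖deriv γ t‖ := by
    intro t ht
    have h2 : (1:ℝ) < ρ t := (hE2 ht.2).1
    have hne : γ t ≠ 0 := by intro h; simp only [hρ, h, norm_zero] at h2; linarith
    have hnd : DifferentiableAt ℝ (fun z : ℂ => ‖z‖) (γ t) := differentiableAt_id.norm ℝ hne
    have hcd : HasDerivAt ρ (fderiv ℝ (fun z : ℂ => ‖z‖) (γ t) (deriv γ t)) t :=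
      hnd.hasFDerivAt.comp_hasDerivAt t (hγd t)
    rw [hcd.deriv, ← Real.norm_eq_abs]
    refine (ContinuousLinearMap.le_opNorm _ _).trans ?_
    rw [norm_fderiv_norm hnd, one_mul]
  have hvolE : volume E ≤ ∫⁻ t in T, ENNReal.ofReal ‖deriv γ t‖ := by
    refine (measure_mono hsub).trans ?_
    refine (addHaar_image_le_lintegral_abs_det_fderiv (μ := volume) (f := ρ)
      (f' := fun t => ContinuousLinearMap.toSpanSingleton ℝ (deriv ρ t)) hTm
      fun t ht => (hdρ t ht).hasDerivAt.hasFDerivAt.hasFDerivWithinAt).trans ?_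
    refine setLIntegral_mono (by fun_prop) fun t ht => ?_
    rw [ContinuousLinearMap.det_toSpanSingleton]
    exact ENNReal.ofReal_le_ofReal (hρ' t ht)
  have hcont : ContinuousOn (fun t => Real.exp (u (γ t)) * ‖deriv γ t‖) (Set.Icc 0 1) := by
    refine ContinuousOn.mul ?_ hγ'.norm.continuousOn
    exact Real.continuous_exp.comp_continuousOn
      (hu.comp hγc.continuousOn fun t ht => hS t ht)
  have hint : IntegrableOn (fun t => Real.exp (u (γ t)) * ‖deriv γ t‖) (Set.Ioc 0 1) :=
    (hcont.integrableOn_compact isCompact_Icc).mono_set Set.Ioc_subset_Icc_self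
  have hnn : ∀ t, 0 ≤ Real.exp (u (γ t)) * ‖deriv γ t‖ := fun t => by positivity
  have hlen : ENNReal.ofReal (confLen u γ) =
      ∫⁻ t in Set.Ioc 0 1, ENNReal.ofReal (Real.exp (u (γ t)) * ‖deriv γ t‖) := by
    unfold confLen
    rw [intervalIntegral.integral_of_le zero_le_one,
      ofReal_integral_eq_lintegral_ofReal hint (Eventually.of_forall hnn)]
  have hl0 : 0 ≤ confLen u γ := intervalIntegral.integral_nonneg zero_le_one fun t _ => hnn t
  rw [← ENNReal.ofReal_le_ofReal_iff hl0, hlen]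
  calc ENNReal.ofReal (1/2 * Real.exp m)
      = ENNReal.ofReal (Real.exp m) * ENNReal.ofReal (1/2) := by
        rw [mul_comm, ENNReal.ofReal_mul (Real.exp_pos _).le]
    _ ≤ ENNReal.ofReal (Real.exp m) * ∫⁻ t in T, ENNReal.ofReal ‖deriv γ t‖ := by
        gcongr; exact hvol.trans hvolE
    _ = ∫⁻ t in T, ENNReal.ofReal (Real.exp m) * ENNReal.ofReal ‖deriv γ t‖ := by
        rw [lintegral_const_mul' _ _ ENNReal.ofReal_ne_top]
    _ ≤ ∫⁻ t in T, ENNReal.ofReal (Real.exp (u (γ t)) * ‖deriv γ t‖) := by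
        refine setLIntegral_mono' hTm fun t ht => ?_
        rw [← ENNReal.ofReal_mul (Real.exp_pos _).le]
        apply ENNReal.ofReal_le_ofReal
        gcongr
        exact hm _ ht.2
    _ ≤ _ := lintegral_mono_set Set.inter_subset_left

theorem area_eq (u : ℂ → ℝ) : confAreaE u (ball (0:ℂ) 2 \ ball (0:ℂ) 1) =
    ∫⁻ x in AA, ENNReal.ofReal (Real.exp (2 * u x)) := by
  unfold confAreaE
  apply setLIntegral_congr
  have hs : ∀ r : ℝ, r ≠ 0 → ∀ᵐ x : ℂ, x ∉ sphere (0:ℂ) r := fun r hr => by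
    have : volume (sphere (0:ℂ) r) = 0 := Measure.addHaar_sphere_of_ne_zero _ _ hr
    exact measure_eq_zero_iff_ae_notMem.1 this
  filter_upwards [hs 1 one_ne_zero, hs 2 two_ne_zero] with x h1 h2
  simp only [mem_sphere_zero_iff_norm] at h1 h2
  refine propext ?_
  change (x ∈ ball (0:ℂ) 2 \ ball (0:ℂ) 1) ↔ x ∈ AA
  simp only [AA, Set.mem_sdiff, mem_ball_zero_iff, sub_zero, Set.mem_ofPred_eq, not_lt]
  constructor
  · rintro ⟨a, b⟩; exact ⟨lt_of_le_of_ne b (Ne.symm h1), a.le⟩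
  · rintro ⟨a, b⟩; exact ⟨lt_of_le_of_ne b h2, a.le⟩

theorem area_lower (u : ℂ → ℝ) (E : Set ℝ)
    (hE : MeasurableSet E) (hE2 : E ⊆ Set.Ioc 1 2) (hvol : ENNReal.ofReal (1/2) ≤ volume E)
    (m : ℝ) (hm : ∀ x : ℂ, ‖x‖ ∈ E → m ≤ u x) :
    ENNReal.ofReal (1/2 * Real.exp (2 * m)) ≤ confAreaE u (ball (0:ℂ) 2 \ ball (0:ℂ) 1) := by
  rw [area_eq]
  set k := ENNReal.ofReal (Real.exp (2 * m)) with hk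
  have hm2 : Measurable (fun x : ℂ => E.indicator (fun _ => k) ‖x‖) :=
    (measurable_const.indicator hE).comp measurable_norm
  calc ENNReal.ofReal (1/2 * Real.exp (2 * m)) = k * ENNReal.ofReal (1/2) := by
        rw [mul_comm, ENNReal.ofReal_mul (Real.exp_pos _).le]
    _ ≤ k * volume E := by gcongr
    _ = ∫⁻ r in Set.Ioc 1 2, E.indicator (fun _ => k) r := by
        rw [lintegral_indicator hE, setLIntegral_const, Measure.restrict_apply hE,
          Set.inter_eq_left.2 hE2]
    _ ≤ ∫⁻ r in Set.Ioc (1:ℝ) 2, ∫⁻ θ in Set.Ioc (-Real.pi) Real.pi,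
      ENNReal.ofReal r * E.indicator (fun _ => k) ‖(0:ℂ) + r * Complex.exp (θ * Complex.I)‖ := by
        refine setLIntegral_mono' measurableSet_Ioc fun r hr => ?_
        have e : ∀ θ : ℝ, ‖(0:ℂ) + r * Complex.exp (θ * Complex.I)‖ = r := fun θ => by
          rw [zero_add, norm_mul, Complex.norm_exp_ofReal_mul_I, Complex.norm_real,
            Real.norm_of_nonneg (by linarith [hr.1])]; simp
        simp only [e, setLIntegral_const, Real.volume_Ioc]
        rw [mul_assoc, mul_comm (E.indicator _ _), ← mul_assoc]
        refine le_mul_of_one_le_left' ?_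
        rw [← ENNReal.ofReal_mul (by linarith [hr.1]), ENNReal.one_le_ofReal]
        nlinarith [hr.1, Real.pi_gt_three]
    _ = ∫⁻ x in AA, E.indicator (fun _ => k) ‖x‖ := by
        rw [polar_ann 0 (fun x => E.indicator (fun _ => k) ‖x‖) hm2 1 2 zero_le_one]; rfl
    _ ≤ _ := by
        refine lintegral_mono fun x => ?_
        by_cases h : ‖x‖ ∈ E
        · simp only [h, Set.indicator_of_mem, hk]
          apply ENNReal.ofReal_le_ofReal
          gcongr
          exact hm x h
        · simp [h]

theorem area_upper (u : ℂ → ℝ) (c : ℝ) (B : ℝ≥0∞)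
    (hB : ∫⁻ x in AA, ENNReal.ofReal (Real.exp (3 * (u x - c))) ≤ B) :
    confAreaE u (ball (0:ℂ) 2 \ ball (0:ℂ) 1) ≤
      ENNReal.ofReal (Real.exp (2 * c)) * (volume AA + B) := by
  rw [area_eq]
  calc _ ≤ ∫⁻ x in AA, ENNReal.ofReal (Real.exp (2 * c)) *
        (1 + ENNReal.ofReal (Real.exp (3 * (u x - c)))) := by
        refine lintegral_mono fun x => ?_
        rw [← ENNReal.ofReal_one, ← ENNReal.ofReal_add zero_le_one (Real.exp_pos _).le,
          ← ENNReal.ofReal_mul (Real.exp_pos _).le]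
        apply ENNReal.ofReal_le_ofReal
        rw [show 2 * u x = 2 * c + 2 * (u x - c) by ring, Real.exp_add]
        gcongr
        rcases le_total 0 (u x - c) with h | h
        · have : Real.exp (2 * (u x - c)) ≤ Real.exp (3 * (u x - c)) :=
            Real.exp_le_exp.2 (by linarith)
          linarith
        · have : Real.exp (2 * (u x - c)) ≤ 1 := Real.exp_le_one_iff.2 (by linarith)
          linarith [Real.exp_pos (3 * (u x - c))]
    _ = ENNReal.ofReal (Real.exp (2 * c)) * (volume AA +
        ∫⁻ x in AA, ENNReal.ofReal (Real.exp (3 * (u x - c)))) := by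
        rw [lintegral_const_mul' _ _ ENNReal.ofReal_ne_top, lintegral_add_left measurable_const]
        simp
    _ ≤ _ := by gcongr

def KK : ℝ≥0∞ := ∫⁻ t in Set.Ioc (0:ℝ) 1, ENNReal.ofReal ((t * (1 - t)) ^ (-(1/2) : ℝ))

theorem KK_fin : KK ≠ ⊤ := by
  have i1 : IntegrableOn (fun t : ℝ => t ^ (-(1/2) : ℝ)) (Set.Ioc 0 1) :=
    (intervalIntegrable_iff_integrableOn_Ioc_of_le zero_le_one).1
      (intervalIntegral.intervalIntegrable_rpow' (by norm_num))
  have i2 : IntegrableOn (fun t : ℝ => (1 - t) ^ (-(1/2) : ℝ)) (Set.Ioc 0 1) := by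
    rw [← intervalIntegrable_iff_integrableOn_Ioc_of_le zero_le_one]
    have := (intervalIntegral.intervalIntegrable_rpow' (a := 1) (b := 0)
      (r := (-(1/2) : ℝ)) (by norm_num)).comp_sub_left 1
    simpa using this
  have i3 := (i1.const_mul 2).add (i2.const_mul 2)
  have h3 := (Integrable.lintegral_lt_top i3)
  refine (lt_of_le_of_lt ?_ h3).ne
  unfold KK
  refine setLIntegral_mono' measurableSet_Ioc fun t ht => ENNReal.ofReal_le_ofReal ?_
  simp only [Pi.add_apply]
  have h0 : 0 < t := ht.1
  have h1 : 0 ≤ 1 - t := by linarith [ht.2]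
  rw [Real.mul_rpow h0.le h1]
  have ht0 : 0 ≤ t ^ (-(1/2) : ℝ) := Real.rpow_nonneg h0.le _
  have ht1 : 0 ≤ (1 - t) ^ (-(1/2) : ℝ) := Real.rpow_nonneg h1 _
  have half : ∀ x : ℝ, 1/2 ≤ x → x ≤ 1 → x ^ (-(1/2) : ℝ) ≤ 2 := by
    intro x hx hx1
    calc x ^ (-(1/2) : ℝ) ≤ x ^ (-1 : ℝ) :=
          Real.rpow_le_rpow_of_exponent_ge (by linarith) hx1 (by norm_num)
      _ = x⁻¹ := Real.rpow_neg_one x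
      _ ≤ (1/2)⁻¹ := by gcongr
      _ = 2 := by norm_num
  rcases le_total (1/2) t with h | h
  · have := half t h ht.2
    nlinarith
  · have := half (1 - t) (by linarith) (by linarith)
    nlinarith

theorem young (X τ : ℝ) (hX : 0 < X) (hτ : 0 < τ) :
    X ≤ τ ^ (-(1/2) : ℝ) + τ * X ^ 3 := by
  have hp : 0 < τ ^ (-(1/2) : ℝ) := Real.rpow_pos_of_pos hτ _
  rcases le_total X (τ ^ (-(1/2) : ℝ)) with h | h
  · have : 0 ≤ τ * X ^ 3 := by positivity
    linarith
  · have h2 : (τ ^ (-(1/2) : ℝ)) ^ 2 = τ⁻¹ := by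
      rw [← Real.rpow_natCast, ← Real.rpow_mul hτ.le]
      norm_num
      exact Real.rpow_neg_one τ
    have h3 : τ⁻¹ ≤ X ^ 2 := by rw [← h2]; gcongr
    have h4 : 1 ≤ τ * X ^ 2 := by
      calc (1:ℝ) = τ * τ⁻¹ := by field_simp
        _ ≤ _ := by gcongr
    nlinarith

def pth (θ α s t : ℝ) : ℂ := cpt 0 (1 + t) (θ + t * α + s * (t * (1 - t)))

theorem pth_cont (θ α : ℝ) : Continuous fun p : ℝ × ℝ => pth θ α p.1 p.2 := by
  unfold pth cpt; fun_prop

theorem pth_contDiff (θ α s : ℝ) : ContDiff ℝ 1 (pth θ α s) := by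
  unfold pth cpt
  have h : ContDiff ℝ 1 (fun t : ℝ => (t : ℂ)) := Complex.ofRealCLM.contDiff
  have h1 : ContDiff ℝ 1 (fun t : ℝ => ((1 + t : ℝ) : ℂ)) := h.comp (by fun_prop)
  have h2 : ContDiff ℝ 1 (fun t : ℝ => ((θ + t * α + s * (t * (1 - t)) : ℝ) : ℂ)) :=
    h.comp (by fun_prop)
  exact contDiff_const.add (h1.mul (Complex.contDiff_exp.comp (h2.mul contDiff_const)))

theorem pth_norm (θ α s t : ℝ) (ht : 0 ≤ t) : ‖pth θ α s t‖ = 1 + t := by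
  unfold pth cpt
  rw [zero_add, norm_mul, Complex.norm_exp_ofReal_mul_I, Complex.norm_real,
    Real.norm_of_nonneg (by linarith), mul_one]

theorem pth_deriv (θ α s t : ℝ) (ht : t ∈ Set.Icc (0:ℝ) 1) (hs : s ∈ Set.Icc (0:ℝ) 1)
    (hα : |α| ≤ Real.pi) : ‖deriv (pth θ α s) t‖ ≤ 10 := by
  have h1 : HasDerivAt (fun t : ℝ => ((1 + t : ℝ) : ℂ)) ((1:ℝ):ℂ) t :=
    ((hasDerivAt_id t).const_add 1).ofReal_comp
  have h2' : HasDerivAt (fun t : ℝ => θ + t * α + s * (t * (1 - t))) (α + s * (1 - 2 * t)) t := by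
    have a := ((hasDerivAt_id t).mul_const α).const_add θ
    have b := ((hasDerivAt_id t).mul ((hasDerivAt_id t).const_sub 1)).const_mul s
    exact (a.add b).congr_deriv (by simp only [id]; ring)
  have h2 := (h2'.ofReal_comp.mul_const Complex.I).cexp
  have h3 := (h1.mul h2).const_add (0:ℂ)
  have e : deriv (pth θ α s) t = _ := h3.deriv
  rw [e]
  refine (norm_add_le _ _).trans ?_
  have hp := Real.pi_lt_d2
  have hb : |α + s * (1 - 2 * t)| ≤ Real.pi + 1 := by
    have := abs_le.1 hα
    obtain ⟨s0, s1⟩ := hs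
    obtain ⟨t0, t1⟩ := ht
    rw [abs_le]; constructor <;> nlinarith
  simp only [norm_mul, Complex.norm_exp_ofReal_mul_I, Complex.norm_real, Complex.norm_I,
    Real.norm_eq_abs, mul_one, one_mul, abs_one]
  rw [abs_of_nonneg (by linarith [ht.1] : 0 ≤ 1 + t)]
  have h0 := abs_nonneg (α + s * (1 - 2 * t))
  have : (1 + t) * |α + s * (1 - 2 * t)| ≤ 2 * (Real.pi + 1) := by
    gcongr; linarith [ht.2]
  linarith

theorem angle_int (f : ℝ → ℝ) (hf : Continuous f) (h0 : ∀ x, 0 ≤ f x)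
    (hper : Function.Periodic f (2 * Real.pi)) (β τ : ℝ) (hτ : 0 ≤ τ) (hτ1 : τ ≤ 1) :
    ∫⁻ s in Set.Ioc (0:ℝ) 1, ENNReal.ofReal (τ * f (β + s * τ)) ≤
      ∫⁻ φ in Set.Ioc (-Real.pi) Real.pi, ENNReal.ofReal (f φ) := by
  have hpi := Real.pi_gt_three
  have hi : ∀ a b, IntervalIntegrable f volume a b := fun a b => hf.intervalIntegrable a b
  have hg : Continuous fun s : ℝ => τ * f (β + s * τ) := by fun_prop
  have e1 : ∫⁻ s in Set.Ioc (0:ℝ) 1, ENNReal.ofReal (τ * f (β + s * τ)) =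
      ENNReal.ofReal (∫ s in (0:ℝ)..1, τ * f (β + s * τ)) := by
    rw [intervalIntegral.integral_of_le zero_le_one, ofReal_integral_eq_lintegral_ofReal]
    · exact (intervalIntegrable_iff_integrableOn_Ioc_of_le zero_le_one).1 (hg.intervalIntegrable _ _)
    · exact Eventually.of_forall fun s => mul_nonneg hτ (h0 _)
  have e2 : ∫⁻ φ in Set.Ioc (-Real.pi) Real.pi, ENNReal.ofReal (f φ) =
      ENNReal.ofReal (∫ φ in (-Real.pi)..Real.pi, f φ) := by
    rw [intervalIntegral.integral_of_le (by linarith), ofReal_integral_eq_lintegral_ofReal]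
    · exact (intervalIntegrable_iff_integrableOn_Ioc_of_le (by linarith)).1 (hi _ _)
    · exact Eventually.of_forall fun s => h0 _
  rw [e1, e2]
  apply ENNReal.ofReal_le_ofReal
  have e3 : ∫ s in (0:ℝ)..1, τ * f (β + s * τ) = ∫ φ in β..(β + τ), f φ := by
    rw [intervalIntegral.integral_const_mul]
    have := intervalIntegral.mul_integral_comp_add_mul (f := f) (a := 0) (b := 1) τ β
    simp only [mul_zero, add_zero, mul_one] at this
    rw [← this]
    simp only [mul_comm τ]
  have e4 := hper.intervalIntegral_add_eq (-Real.pi) β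
  rw [show -Real.pi + 2 * Real.pi = Real.pi by ring] at e4
  rw [e3, e4]
  exact intervalIntegral.integral_mono_interval le_rfl (by linarith) (by linarith)
    (Eventually.of_forall h0) (hi _ _)

theorem radial_int (v : ℂ → ℝ) (hv : Continuous v) (c : ℝ) (B : ℝ≥0∞)
    (hB : ∫⁻ x in AA, ENNReal.ofReal (Real.exp (3 * (v x - c))) ≤ B) :
    ∫⁻ t in Set.Ioc (0:ℝ) 1, ∫⁻ φ in Set.Ioc (-Real.pi) Real.pi,
      ENNReal.ofReal (Real.exp (3 * (v (cpt 0 (1 + t) φ) - c))) ≤ B := by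
  have hpre : Set.Ioc (0:ℝ) 1 = (fun t => 1 + t) ⁻¹' (Set.Ioc (1:ℝ) 2) := by
    rw [Set.preimage_const_add_Ioc]; norm_num
  have := (measurePreserving_add_left volume (1:ℝ)).setLIntegral_comp_preimage_emb
    (measurableEmbedding_addLeft 1) (fun r => ∫⁻ φ in Set.Ioc (-Real.pi) Real.pi,
      ENNReal.ofReal (Real.exp (3 * (v (cpt 0 r φ) - c)))) (Set.Ioc (1:ℝ) 2)
  rw [hpre, this]
  refine le_trans ?_ hB
  have hm : Measurable fun x => ENNReal.ofReal (Real.exp (3 * (v x - c))) := by fun_prop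
  have hp := polar_ann 0 (fun x => ENNReal.ofReal (Real.exp (3 * (v x - c)))) hm 1 2 zero_le_one
  change _ ≤ ∫⁻ y in {y : ℂ | 1 < ‖y - 0‖ ∧ ‖y - 0‖ ≤ 2}, _
  rw [← hp]
  refine setLIntegral_mono' measurableSet_Ioc fun r hr => ?_
  refine lintegral_mono fun φ => ?_
  refine le_mul_of_one_le_left' ?_
  rw [ENNReal.one_le_ofReal]
  exact hr.1.le

theorem dist_upper (u v : ℂ → ℝ) (hv : Continuous v)
    (h : ∀ y, 1/2 < ‖y‖ → ‖y‖ < 3 → v y = u y) (c : ℝ) (B : ℝ≥0∞)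
    (hB : ∫⁻ x in AA, ENNReal.ofReal (Real.exp (3 * (v x - c))) ≤ B) (θ θ' : ℝ) :
    (PathsIn (ball (0:ℂ) 4 \ closedBall (0:ℂ) (1/4)) (Complex.exp ((θ : ℂ) * Complex.I))
      ((2:ℂ) * Complex.exp ((θ' : ℂ) * Complex.I))).Nonempty ∧
    ENNReal.ofReal (confDist u (ball (0:ℂ) 4 \ closedBall (0:ℂ) (1/4))
      (Complex.exp ((θ : ℂ) * Complex.I)) ((2:ℂ) * Complex.exp ((θ' : ℂ) * Complex.I))) ≤
      ENNReal.ofReal (10 * Real.exp c) * (KK + B) := by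
  set z := Complex.exp (((θ' - θ : ℝ) : ℂ) * Complex.I) with hz
  set α := z.arg with hαd
  have hα : |α| ≤ Real.pi := Complex.abs_arg_le_pi z
  have hze : Complex.exp ((α:ℂ) * Complex.I) = z := by
    have := Complex.norm_mul_exp_arg_mul_I z
    have hn : ‖z‖ = 1 := by rw [hz, Complex.norm_exp_ofReal_mul_I]
    rw [hn, Complex.ofReal_one, one_mul] at this
    exact this
  have hpath : ∀ s, pth θ α s ∈ PathsIn (ball (0:ℂ) 4 \ closedBall (0:ℂ) (1/4))
      (Complex.exp ((θ : ℂ) * Complex.I)) ((2:ℂ) * Complex.exp ((θ' : ℂ) * Complex.I)) := by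
    intro s
    refine ⟨by simp [pth, cpt], ?_, ?_, pth_contDiff _ _ _⟩
    · simp only [pth, cpt]
      have : (((θ + 1 * α + s * (1 * (1 - 1)) : ℝ)) : ℂ) * Complex.I =
          (θ : ℂ) * Complex.I + (α : ℂ) * Complex.I := by push_cast; ring
      rw [this, Complex.exp_add, hze, hz, ← Complex.exp_add]
      rw [show (θ : ℂ) * Complex.I + ((θ' - θ : ℝ) : ℂ) * Complex.I = (θ' : ℂ) * Complex.I by
        push_cast; ring]
      push_cast; ring
    · intro t ht
      simp only [Set.mem_sdiff, mem_ball_zero_iff, mem_closedBall_zero_iff, not_le,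
        pth_norm θ α s t ht.1]
      constructor <;> linarith [ht.1, ht.2]
  refine ⟨⟨_, hpath 0⟩, ?_⟩
  have hbdd : BddBelow (confLen u '' PathsIn (ball (0:ℂ) 4 \ closedBall (0:ℂ) (1/4))
      (Complex.exp ((θ : ℂ) * Complex.I)) ((2:ℂ) * Complex.exp ((θ' : ℂ) * Complex.I))) := by
    refine ⟨0, ?_⟩
    rintro _ ⟨γ, _, rfl⟩
    exact intervalIntegral.integral_nonneg zero_le_one fun t _ => by positivity
  set d := confDist u (ball (0:ℂ) 4 \ closedBall (0:ℂ) (1/4))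
      (Complex.exp ((θ : ℂ) * Complex.I)) ((2:ℂ) * Complex.exp ((θ' : ℂ) * Complex.I)) with hd
  have hdle : ∀ s, d ≤ confLen u (pth θ α s) := fun s => csInf_le hbdd ⟨_, hpath s, rfl⟩
  have hlen : ∀ s ∈ Set.Ioc (0:ℝ) 1, ENNReal.ofReal d ≤ ENNReal.ofReal (10 * Real.exp c) *
      ∫⁻ t in Set.Ioc (0:ℝ) 1, ENNReal.ofReal (Real.exp (v (pth θ α s t) - c)) := by
    intro s hs
    refine (ENNReal.ofReal_le_ofReal (hdle s)).trans ?_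
    have e1 : confLen u (pth θ α s) = confLen v (pth θ α s) := by
      unfold confLen
      refine intervalIntegral.integral_congr fun t ht => ?_
      rw [Set.uIcc_of_le zero_le_one] at ht
      rw [h] <;> rw [pth_norm θ α s t ht.1] <;> linarith [ht.1, ht.2]
    rw [e1]
    unfold confLen
    have hcd := (pth_contDiff θ α s).continuous_deriv le_rfl
    have hc := (pth_contDiff θ α s).continuous
    have hcont : Continuous fun t => Real.exp (v (pth θ α s t)) * ‖deriv (pth θ α s) t‖ := by
      fun_prop
    rw [intervalIntegral.integral_of_le zero_le_one, ofReal_integral_eq_lintegral_ofReal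
      ((intervalIntegrable_iff_integrableOn_Ioc_of_le zero_le_one).1
        (hcont.intervalIntegrable _ _)) (Eventually.of_forall fun t => by positivity),
      ← lintegral_const_mul' _ _ ENNReal.ofReal_ne_top]
    refine setLIntegral_mono' measurableSet_Ioc fun t ht => ?_
    rw [← ENNReal.ofReal_mul (by positivity)]
    apply ENNReal.ofReal_le_ofReal
    have := pth_deriv θ α s t ⟨ht.1.le, ht.2⟩ ⟨hs.1.le, hs.2⟩ hα
    calc _ ≤ Real.exp (v (pth θ α s t)) * 10 := by gcongr
      _ = 10 * Real.exp c * Real.exp (v (pth θ α s t) - c) := by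
        rw [mul_assoc, ← Real.exp_add]; ring_nf
  calc ENNReal.ofReal d = ∫⁻ s in Set.Ioc (0:ℝ) 1, ENNReal.ofReal d := by simp
    _ ≤ ∫⁻ s in Set.Ioc (0:ℝ) 1, ENNReal.ofReal (10 * Real.exp c) *
      ∫⁻ t in Set.Ioc (0:ℝ) 1, ENNReal.ofReal (Real.exp (v (pth θ α s t) - c)) :=
        setLIntegral_mono' measurableSet_Ioc hlen
    _ = ENNReal.ofReal (10 * Real.exp c) * ∫⁻ t in Set.Ioc (0:ℝ) 1, ∫⁻ s in Set.Ioc (0:ℝ) 1,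
        ENNReal.ofReal (Real.exp (v (pth θ α s t) - c)) := by
        rw [lintegral_const_mul' _ _ ENNReal.ofReal_ne_top, lintegral_lintegral_swap]
        have := pth_cont θ α
        have h2 : Measurable fun p : ℝ × ℝ =>
          ENNReal.ofReal (Real.exp (v (pth θ α p.1 p.2) - c)) := by fun_prop
        exact h2.aemeasurable
    _ ≤ ENNReal.ofReal (10 * Real.exp c) * ∫⁻ t in Set.Ioc (0:ℝ) 1,
        (ENNReal.ofReal ((t * (1 - t)) ^ (-(1/2) : ℝ)) +
          ∫⁻ φ in Set.Ioc (-Real.pi) Real.pi,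
            ENNReal.ofReal (Real.exp (3 * (v (cpt 0 (1 + t) φ) - c)))) := by
        refine mul_le_mul_right ?_ _
        rw [← restrict_Ioo_eq_restrict_Ioc]
        refine setLIntegral_mono' measurableSet_Ioo fun t ht => ?_
        have hτ : 0 < t * (1 - t) := mul_pos ht.1 (by linarith [ht.2])
        have hτ1 : t * (1 - t) ≤ 1 := by nlinarith [ht.1, ht.2]
        set f : ℝ → ℝ := fun φ => Real.exp (3 * (v (cpt 0 (1 + t) φ) - c)) with hf
        have hfc : Continuous f := by
          have : Continuous fun φ => cpt 0 (1 + t) φ := by unfold cpt; fun_prop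
          simp only [hf]; fun_prop
        have hfp : Function.Periodic f (2 * Real.pi) := by
          intro φ
          have := cpt_per v 0 (1 + t) φ
          simp only at this
          simp only [hf, this]
        have ha := angle_int f hfc (fun _ => (Real.exp_pos _).le) hfp (θ + t * α) (t * (1 - t))
          hτ.le hτ1
        rw [restrict_Ioo_eq_restrict_Ioc]
        calc _ ≤ ∫⁻ s in Set.Ioc (0:ℝ) 1, (ENNReal.ofReal ((t * (1 - t)) ^ (-(1/2) : ℝ)) +
              ENNReal.ofReal (t * (1 - t) * f (θ + t * α + s * (t * (1 - t))))) := by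
              refine lintegral_mono fun s => ?_
              rw [← ENNReal.ofReal_add (Real.rpow_nonneg hτ.le _)
                (mul_nonneg hτ.le (Real.exp_pos _).le)]
              apply ENNReal.ofReal_le_ofReal
              refine (young _ _ (Real.exp_pos _) hτ).trans_eq ?_
              rw [← Real.exp_nat_mul]
              simp [pth]
          _ = ENNReal.ofReal ((t * (1 - t)) ^ (-(1/2) : ℝ)) +
              ∫⁻ s in Set.Ioc (0:ℝ) 1,
                ENNReal.ofReal (t * (1 - t) * f (θ + t * α + s * (t * (1 - t)))) := by
              rw [lintegral_add_left measurable_const]; simp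
          _ ≤ _ := by gcongr
    _ ≤ _ := by
        refine mul_le_mul_right ?_ _
        rw [lintegral_add_left (by fun_prop)]
        exact add_le_add le_rfl (radial_int v hv c B hB)

/-- neck estimate on the annulus `D_4 \ D_{1/4}`: distances across the annulus
and the area of `D_2 \ D` are comparable to `e^c` resp. `e^{2c}`, `c` being the mean value
of `u` on `∂D_{3/2}`. -/
theorem statement5 (Λ₃ : ℝ) (hΛ₃ : 0 < Λ₃) :
    ∃ ε₂ C₁ C₂ C₁' C₂' : ℝ,
      0 < ε₂ ∧ 0 < C₁ ∧ 0 < C₂ ∧ 0 < C₁' ∧ 0 < C₂' ∧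
      ∀ u : ℂ → ℝ,
        ContDiffOn ℝ (⊤ : ℕ∞) u (ball (0:ℂ) 4 \ closedBall (0:ℂ) (1/4)) →
        wL2Bound (fun x => ‖fderiv ℝ u x‖) (ball (0:ℂ) 4 \ closedBall (0:ℂ) (1/4)) Λ₃ →
        curvIntE u (ball (0:ℂ) 4 \ closedBall (0:ℂ) (1/2)) < ENNReal.ofReal ε₂ →
        (∀ θ θ' : ℝ,
          C₁ * Real.exp (circMean u (3/2)) ≤
              confDist u (ball (0:ℂ) 4 \ closedBall (0:ℂ) (1/4))
                (Complex.exp ((θ : ℂ) * Complex.I))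
                ((2:ℂ) * Complex.exp ((θ' : ℂ) * Complex.I)) ∧
            confDist u (ball (0:ℂ) 4 \ closedBall (0:ℂ) (1/4))
                (Complex.exp ((θ : ℂ) * Complex.I))
                ((2:ℂ) * Complex.exp ((θ' : ℂ) * Complex.I)) ≤
              C₂ * Real.exp (circMean u (3/2))) ∧
        (ENNReal.ofReal (C₁' * Real.exp (2 * circMean u (3/2))) ≤
            confAreaE u (ball (0:ℂ) 2 \ ball (0:ℂ) 1) ∧
          confAreaE u (ball (0:ℂ) 2 \ ball (0:ℂ) 1) ≤
            ENNReal.ofReal (C₂' * Real.exp (2 * circMean u (3/2)))) := by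
  obtain ⟨M, hM, hgrad⟩ := grad_bd Λ₃ hΛ₃
  have hKP : KP ≠ ⊤ := by
    unfold KP
    exact ENNReal.mul_ne_top ENNReal.ofReal_ne_top (ENNReal.mul_ne_top ENNReal.ofReal_ne_top
      (ENNReal.add_ne_top.2 ⟨ENNReal.one_ne_top, ENNReal.ofReal_ne_top⟩))
  have h64 : 64 * (KP * M) ≠ ⊤ := ENNReal.mul_ne_top (by norm_num) (ENNReal.mul_ne_top hKP hM)
  set C0 := (64 * (KP * M)).toReal with hC0d
  have hC0 : 0 ≤ C0 := ENNReal.toReal_nonneg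
  set B : ℝ≥0∞ := ENNReal.ofReal (Real.exp (3 * C0)) * (volume AA + (volume AA + J2)) with hBd
  have hBf : B ≠ ⊤ := ENNReal.mul_ne_top ENNReal.ofReal_ne_top (by simp [AA_fin, J2_fin])
  have hLL0 : 0 ≤ LL.toReal := ENNReal.toReal_nonneg
  have hKKB : KK + B ≠ ⊤ := ENNReal.add_ne_top.2 ⟨KK_fin, hBf⟩
  have hAB : volume AA + B ≠ ⊤ := ENNReal.add_ne_top.2 ⟨by simp [AA_fin], hBf⟩
  have hn1 : 0 ≤ (KK + B).toReal := ENNReal.toReal_nonneg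
  have hn2 : 0 ≤ (volume AA + B).toReal := ENNReal.toReal_nonneg
  refine ⟨min 1 (1 / (2 * (LL.toReal + 1))), 1/2 * Real.exp (-(C0 + 1)),
    10 * (KK + B).toReal + 1, 1/2 * Real.exp (2 * (-(C0 + 1))), (volume AA + B).toReal + 1,
    by positivity, by positivity, by positivity, by positivity, by positivity, ?_⟩
  intro u hu hw hK
  obtain ⟨v, hv, h⟩ := cutoff_ex u hu
  have hLI := (LI_le h).trans hK.le
  have hL1 : LI v ≤ 1 := hLI.trans (by
    rw [← ENNReal.ofReal_one]; exact ENNReal.ofReal_le_ofReal (min_le_left _ _))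
  have hL2 : LI v * LL ≤ ENNReal.ofReal (1/2) := by
    calc LI v * LL ≤ ENNReal.ofReal (1 / (2 * (LL.toReal + 1))) * ENNReal.ofReal LL.toReal := by
          rw [ENNReal.ofReal_toReal (by simp [LL_fin])]
          gcongr
          exact hLI.trans (ENNReal.ofReal_le_ofReal (min_le_right _ _))
      _ = ENNReal.ofReal (1 / (2 * (LL.toReal + 1)) * LL.toReal) :=
          (ENNReal.ofReal_mul (by positivity)).symm
      _ ≤ _ := by
          apply ENNReal.ofReal_le_ofReal
          rw [div_mul_eq_mul_div, div_le_div_iff₀ (by positivity) (by positivity)]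
          linarith
  have hG : 64 * (KP * GI v) ≤ ENNReal.ofReal C0 := by
    rw [hC0d, ENNReal.ofReal_toReal h64, GI_eq h]
    gcongr
    exact hgrad u hw
  have h3 := exp3_int v hv hL1 C0 hC0 hG
  obtain ⟨E, hE, hE2, hEv, hEm⟩ := good_radii v hv hL2 C0 hC0 hG
  rw [circMean_eq h]
  set c := cmean v 0 (3/2) with hc
  have hAAm : ∀ x ∈ AA, v x = u x := by
    intro x hx
    simp only [AA, sub_zero, Set.mem_ofPred_eq] at hx
    exact h x (by linarith [hx.1]) (by linarith [hx.2])
  have h3u : ∫⁻ x in AA, ENNReal.ofReal (Real.exp (3 * (u x - c))) ≤ B := by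
    refine le_trans (le_of_eq ?_) h3
    refine setLIntegral_congr_fun AA_meas fun x hx => ?_
    simp only [hAAm x hx]
  have hEu : ∀ x : ℂ, ‖x‖ ∈ E → c - (C0 + 1) ≤ u x := by
    intro x hx
    have := hE2 hx
    rw [← h x (by linarith [this.1]) (by linarith [this.2])]
    exact hEm x hx
  refine ⟨fun θ θ' => ?_, ?_, ?_⟩
  · obtain ⟨hne, hup⟩ := dist_upper u v hv.continuous h c B h3 θ θ'
    constructor
    · refine le_csInf (hne.image _) ?_
      rintro _ ⟨γ, hγ, rfl⟩
      have := confLen_lower u _ hu.continuousOn E hE hE2 hEv _ hEu _ _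
        (Complex.norm_exp_ofReal_mul_I θ) (by
          rw [norm_mul, Complex.norm_exp_ofReal_mul_I]; norm_num) γ hγ
      refine le_trans (le_of_eq ?_) this
      rw [mul_assoc, ← Real.exp_add]; ring_nf
    · have hpos : 0 ≤ 10 * Real.exp c * (KK + B).toReal := by positivity
      rw [← ENNReal.ofReal_toReal hKKB, ← ENNReal.ofReal_mul (by positivity),
        ENNReal.ofReal_le_ofReal_iff hpos] at hup
      have := Real.exp_pos c
      nlinarith
  · refine le_trans (le_of_eq ?_) (area_lower u E hE hE2 hEv _ hEu)
    congr 1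
    rw [mul_assoc, ← Real.exp_add]; ring_nf
  · refine (area_upper u c B h3u).trans ?_
    rw [← ENNReal.ofReal_toReal hAB, ← ENNReal.ofReal_mul (by positivity)]
    apply ENNReal.ofReal_le_ofReal
    have := Real.exp_pos (2 * c)
    rw [ENNReal.ofReal_toReal hAB]
    nlinarith
end
end

section
/- Let u solve −Δu = f on the unit disk D in the sense of distributions. If ‖f‖_{L¹(D)} < ε₁ and ‖u‖_{L¹(D)} < Λ₃, then for every r < 1 and every q < 4π/ε₁, ‖e^{|u|}‖_{L^q(D_r)} < C(q, Λ₃, r). -/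
open MeasureTheory Filter Metric
open scoped Topology ENNReal

noncomputable section

def Th (s : ℝ) : ℝ := Real.smoothTransition (2 * s - 1) * Real.log s

def Tk (s : ℝ) : ℝ := 4 * deriv Th s + 4 * s * deriv (deriv Th) s

lemma Th_of_le {s : ℝ} (h : s ≤ 1/2) : Th s = 0 := by
  unfold Th
  rw [Real.smoothTransition.zero_of_nonpos (by linarith), zero_mul]

lemma Th_of_ge {s : ℝ} (h : 1 ≤ s) : Th s = Real.log s := by
  unfold Th
  rw [Real.smoothTransition.one_of_one_le (by linarith), one_mul]

lemma Th_contDiff : ContDiff ℝ (⊤ : ℕ∞) Th := by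
  rw [contDiff_iff_contDiffAt]
  intro s
  by_cases h : s < 1/2
  · have : Th =ᶠ[𝓝 s] fun _ => 0 := by
      filter_upwards [Iio_mem_nhds h] with t ht using Th_of_le (le_of_lt ht)
    exact contDiffAt_const.congr_of_eventuallyEq this
  · have hs : s ≠ 0 := by intro h0; apply h; rw [h0]; norm_num
    unfold Th
    apply ContDiffAt.mul
    · exact Real.smoothTransition.contDiff.contDiffAt.comp s (by fun_prop)
    · exact Real.contDiffAt_log.2 hs

lemma Th_d1 : ContDiff ℝ (⊤ : ℕ∞) (deriv Th) := by
  have := (contDiff_infty_iff_deriv (𝕜 := ℝ) (f := Th)).1 Th_contDiff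
  exact this.2

lemma Th_d2 : ContDiff ℝ (⊤ : ℕ∞) (deriv (deriv Th)) :=
  ((contDiff_infty_iff_deriv (𝕜 := ℝ) (f := deriv Th)).1 Th_d1).2

lemma Th_hd (s : ℝ) : HasDerivAt Th (deriv Th s) s :=
  (Th_contDiff.differentiable (by simp) s).hasDerivAt

lemma Th_hd2 (s : ℝ) : HasDerivAt (deriv Th) (deriv (deriv Th) s) s :=
  (Th_d1.differentiable (by simp) s).hasDerivAt

lemma Tk_cont : Continuous Tk := by
  unfold Tk
  have h1 := Th_d1.continuous
  have h2 := Th_d2.continuous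
  fun_prop

lemma Th_deriv_gt {s : ℝ} (h : 1 < s) : deriv Th s = s⁻¹ := by
  have : Th =ᶠ[𝓝 s] Real.log := by
    filter_upwards [Ioi_mem_nhds h] with t ht using Th_of_ge (le_of_lt ht)
  rw [this.deriv_eq, Real.deriv_log]

lemma Tk_gt {s : ℝ} (h : 1 < s) : Tk s = 0 := by
  have : deriv Th =ᶠ[𝓝 s] fun t => t⁻¹ := by
    filter_upwards [Ioi_mem_nhds h] with t ht using Th_deriv_gt ht
  unfold Tk
  rw [this.deriv_eq, Th_deriv_gt h, deriv_inv]
  have : s ≠ 0 := by linarith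
  field_simp
  ring

lemma Tk_bdd : ∃ M : ℝ, 0 < M ∧ ∀ s : ℝ, 0 ≤ s → |Tk s| ≤ M := by
  obtain ⟨M, hM⟩ := (isCompact_Icc (a := (0:ℝ)) (b := 1)).exists_bound_of_continuousOn
    Tk_cont.continuousOn
  refine ⟨max M 1, by positivity, fun s hs => ?_⟩
  by_cases h : s ≤ 1
  · exact (hM s ⟨hs, h⟩).trans (le_max_left _ _)
  · rw [Tk_gt (by linarith)]; simp

lemma Tk_int : ∫ z : ℂ, Tk (‖z‖ ^ 2) = 4 * Real.pi := by
  have h := integral_fun_norm_addHaar (volume : Measure ℂ) (fun t : ℝ => Tk (t ^ 2))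
  rw [h]
  have hv : (volume : Measure ℂ).real (ball 0 1) = Real.pi := by
    simp [Measure.real, Complex.volume_ball]
  have hi : ∫ y in Set.Ioi (0:ℝ), y ^ (Module.finrank ℝ ℂ - 1) • Tk (y ^ 2) = 2 := by
    have := integral_Ioi_of_hasDerivAt_of_tendsto' (a := 0) (m := 2)
      (f := fun y : ℝ => 2 * y ^ 2 * deriv Th (y ^ 2))
      (f' := fun y : ℝ => y ^ (Module.finrank ℝ ℂ - 1) • Tk (y ^ 2)) ?_ ?_ ?_
    · rw [this]; simp
    · intro y _
      have h1 : HasDerivAt (fun y : ℝ => y ^ 2) (2 * y) y := by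
        simpa using hasDerivAt_pow 2 y
      have h2 := (Th_hd2 (y ^ 2)).comp y h1
      have h3 := (h1.const_mul 2).mul h2
      refine h3.congr_deriv ?_
      simp [Complex.finrank_real_complex, Tk, Function.comp_def]
      ring
    · have hc : Continuous fun y : ℝ => y ^ (Module.finrank ℝ ℂ - 1) • Tk (y ^ 2) := by
        have := Tk_cont
        fun_prop
      have : IntegrableOn (fun y : ℝ => y ^ (Module.finrank ℝ ℂ - 1) • Tk (y ^ 2))
          (Set.Ioc 0 1 ∪ Set.Ioi 1) := by
        refine IntegrableOn.union ?_ ?_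
        · exact (hc.integrableOn_Icc).mono_set Set.Ioc_subset_Icc_self
        · refine (integrableOn_zero (ε' := ℝ)).congr_fun (fun y hy => ?_) measurableSet_Ioi
          have hy' : 1 < y := hy
          rw [Tk_gt (by nlinarith)]; simp
      rwa [Set.Ioc_union_Ioi_eq_Ioi zero_le_one] at this
    · refine tendsto_const_nhds.congr' ?_
      filter_upwards [eventually_gt_atTop 1] with y hy
      rw [Th_deriv_gt (by nlinarith)]
      have : y ≠ 0 := by linarith
      field_simp
  rw [hi, hv]
  simp [Complex.finrank_real_complex]
  ring

lemma Th_abs_le {s : ℝ} (h0 : 0 < s) (h : s ≤ 1) : Real.log s ≤ Th s ∧ Th s ≤ 0 := by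
  have h1 := Real.smoothTransition.nonneg (2 * s - 1)
  have h2 := Real.smoothTransition.le_one (2 * s - 1)
  have h3 := Real.log_nonpos h0.le h
  unfold Th
  constructor <;> nlinarith

lemma Th_ge {s : ℝ} (h0 : 0 < s) : - Real.log 2 ≤ Th s := by
  by_cases h : s ≤ 1/2
  · rw [Th_of_le h]; have := Real.log_pos one_lt_two; linarith
  by_cases h1 : s ≤ 1
  · refine le_trans ?_ (Th_abs_le h0 h1).1
    rw [← Real.log_inv]; exact Real.log_le_log (by norm_num) (by norm_num at h ⊢; linarith)
  · rw [Th_of_ge (by linarith)]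
    have := Real.log_pos one_lt_two
    have := Real.log_nonneg (x := s) (by linarith)
    linarith

/-- The radial profile (as a function of `s = |z|²`), `a = ε²`, `b = δ²`. -/
def gk (a b s : ℝ) : ℝ := Th (s / a) - Th (s / b) + Real.log (a / b)

lemma gk_zero {a b s : ℝ} (ha : 0 < a) (hab : a ≤ b) (hs : b ≤ s) : gk a b s = 0 := by
  have hb : 0 < b := by linarith
  have hs0 : 0 < s := by linarith
  unfold gk
  rw [Th_of_ge (by rw [le_div_iff₀ ha]; linarith), Th_of_ge (by rw [le_div_iff₀ hb]; linarith),
    Real.log_div hs0.ne' ha.ne', Real.log_div hs0.ne' hb.ne', Real.log_div ha.ne' hb.ne']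
  ring

lemma gk_bound {a b s : ℝ} (ha : 0 < a) (hab : a ≤ b) (hb1 : b ≤ 1) (hs : 0 < s) (hs4 : s ≤ 4) :
    |gk a b s| ≤ Real.log (8 / s) := by
  have hb : 0 < b := by linarith
  have hlog : Real.log (8 / s) = Real.log 8 - Real.log s := Real.log_div (by norm_num) hs.ne'
  have h8 : Real.log 8 = 3 * Real.log 2 := by
    rw [show (8:ℝ) = 2 ^ 3 by norm_num, Real.log_pow]; norm_num
  have h4 : Real.log s ≤ 2 * Real.log 2 := by
    rw [← show Real.log 4 = 2 * Real.log 2 by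
      rw [show (4:ℝ) = 2 ^ 2 by norm_num, Real.log_pow]; norm_num]
    exact Real.log_le_log hs hs4
  have hl2 := Real.log_pos one_lt_two
  by_cases hsb : b ≤ s
  · rw [gk_zero ha hab hsb, abs_zero, hlog]; linarith
  push Not at hsb
  have e1 := Th_abs_le (div_pos hs hb) (by rw [div_le_one hb]; exact hsb.le)
  have e2 := Th_ge (div_pos hs hb)
  have hlb : Real.log b ≤ 0 := Real.log_nonpos hb.le hb1
  have hlab : Real.log a ≤ Real.log b := Real.log_le_log ha hab
  have hlsb : Real.log s ≤ Real.log b := Real.log_le_log hs hsb.le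
  have hx : Real.log s - Real.log b ≤ Th (s / a) + Real.log (a / b) ∧
      Th (s / a) + Real.log (a / b) ≤ 0 := by
    rw [Real.log_div ha.ne' hb.ne']
    by_cases hsa : s ≤ a
    · have := Th_abs_le (div_pos hs ha) (by rw [div_le_one ha]; exact hsa)
      rw [Real.log_div hs.ne' ha.ne'] at this
      constructor <;> linarith
    · rw [Th_of_ge (by rw [le_div_iff₀ ha]; linarith), Real.log_div hs.ne' ha.ne']
      constructor <;> linarith
  unfold gk
  rw [hlog, abs_le]
  constructor <;> linarith [hx.1, hx.2]

lemma gk_contDiff (a b : ℝ) : ContDiff ℝ (⊤ : ℕ∞) (gk a b) := by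
  unfold gk
  have := Th_contDiff
  exact ((this.comp (by fun_prop)).sub (this.comp (by fun_prop))).add contDiff_const

lemma gk_d (a b s : ℝ) : HasDerivAt (gk a b) (deriv Th (s / a) / a - deriv Th (s / b) / b) s := by
  have h (c : ℝ) : HasDerivAt (fun t => Th (t / c)) (deriv Th (s / c) / c) s := by
    have := (Th_hd (s / c)).comp s ((hasDerivAt_id s).div_const c)
    simpa [Function.comp_def, div_eq_mul_inv] using this
  exact ((h a).sub (h b)).add_const _

lemma gk_d2 (a b s : ℝ) : HasDerivAt (fun s => deriv Th (s / a) / a - deriv Th (s / b) / b)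
    (deriv (deriv Th) (s / a) / a ^ 2 - deriv (deriv Th) (s / b) / b ^ 2) s := by
  have h (c : ℝ) : HasDerivAt (fun t => deriv Th (t / c) / c) (deriv (deriv Th) (s / c) / c ^ 2) s := by
    have := ((Th_hd2 (s / c)).comp s ((hasDerivAt_id s).div_const c)).div_const c
    refine this.congr_deriv ?_
    ring
  exact (h a).sub (h b)

lemma lap_radial (h h1 h2 : ℝ → ℝ) (e1 : ∀ s, HasDerivAt h (h1 s) s)
    (e2 : ∀ s, HasDerivAt h1 (h2 s) s) (x y : ℂ) :
    lap (fun y => h (‖y - x‖ ^ 2)) y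
      = 4 * h1 (‖y - x‖ ^ 2) + 4 * ‖y - x‖ ^ 2 * h2 (‖y - x‖ ^ 2) := by
  have hs (y : ℂ) : HasFDerivAt (fun y : ℂ => ‖y - x‖ ^ 2) (2 • (innerSL ℝ (y - x))) y := by
    have := ((hasFDerivAt_id (𝕜 := ℝ) y).sub_const x).norm_sq
    simpa using this
  have hf (y : ℂ) : HasFDerivAt (fun y => h (‖y - x‖ ^ 2))
      (h1 (‖y - x‖ ^ 2) • (2 • (innerSL ℝ (y - x)))) y :=
    (e1 _).comp_hasFDerivAt y (hs y)
  have hfd : fderiv ℝ (fun y => h (‖y - x‖ ^ 2))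
      = fun y => h1 (‖y - x‖ ^ 2) • (2 • (innerSL ℝ (y - x))) := by
    ext1 y; exact (hf y).fderiv
  have hin : HasFDerivAt (fun y : ℂ => 2 • (innerSL ℝ (y - x))) (2 • (innerSL ℝ : ℂ →L[ℝ] ℂ →L[ℝ] ℝ)) y := by
    have : HasFDerivAt (fun y : ℂ => innerSL ℝ (y - x)) (innerSL ℝ : ℂ →L[ℝ] ℂ →L[ℝ] ℝ) y := by
      have := (innerSL ℝ : ℂ →L[ℝ] ℂ →L[ℝ] ℝ).hasFDerivAt.comp y ((hasFDerivAt_id (𝕜 := ℝ) y).sub_const x)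
      rwa [ContinuousLinearMap.comp_id] at this
    exact this.const_smul 2
  have hff := (((e2 _).comp_hasFDerivAt y (hs y)).smul hin).fderiv
  unfold lap
  rw [iteratedFDeriv_two_apply, iteratedFDeriv_two_apply, hfd]
  simp only [Function.comp_def] at hff
  erw [hff]
  rw [← Complex.normSq_eq_norm_sq]
  have i1 : (innerSL ℝ (1:ℂ)) (1:ℂ) = (1:ℝ) := by rw [innerSL_apply_apply]; simp [Complex.inner]
  have i2 : (innerSL ℝ Complex.I) Complex.I = (1:ℝ) := by rw [innerSL_apply_apply]; simp [Complex.inner]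
  simp [Complex.normSq_apply, Complex.inner, i1, i2]
  ring

lemma lap_gk {a b : ℝ} (ha : 0 < a) (hb : 0 < b) (x y : ℂ) :
    lap (fun y => gk a b (‖y - x‖ ^ 2)) y
      = Tk (‖y - x‖ ^ 2 / a) / a - Tk (‖y - x‖ ^ 2 / b) / b := by
  rw [lap_radial _ _ _ (gk_d a b) (gk_d2 a b)]
  unfold Tk
  field_simp
  ring

lemma wk_cont (x : ℂ) (a : ℝ) : Continuous fun y : ℂ => Tk (‖y - x‖ ^ 2 / a) / a := by
  have := Tk_cont
  fun_prop

lemma wk_bound {M : ℝ} (hM : ∀ s : ℝ, 0 ≤ s → |Tk s| ≤ M) (x y : ℂ) {a : ℝ} (ha : 0 < a) :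
    ‖Tk (‖y - x‖ ^ 2 / a) / a‖ ≤ M / a := by
  rw [Real.norm_eq_abs, abs_div, abs_of_pos ha]
  have := hM (‖y - x‖ ^ 2 / a) (by positivity)
  gcongr

lemma wk_int (x : ℂ) {e : ℝ} (he : 0 < e) :
    ∫ y : ℂ, Tk (‖y - x‖ ^ 2 / e ^ 2) / e ^ 2 = 4 * Real.pi := by
  rw [integral_sub_right_eq_self (fun y : ℂ => Tk (‖y‖ ^ 2 / e ^ 2) / e ^ 2) x, integral_div]
  have h := Measure.integral_comp_smul (volume : Measure ℂ) (fun z : ℂ => Tk (‖z‖ ^ 2)) e⁻¹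
  have h2 : ∀ y : ℂ, Tk (‖e⁻¹ • y‖ ^ 2) = Tk (‖y‖ ^ 2 / e ^ 2) := by
    intro y
    rw [norm_smul, mul_pow, norm_inv, Real.norm_of_nonneg he.le]
    congr 1
    field_simp
  simp_rw [h2] at h
  rw [h, Tk_int, Complex.finrank_real_complex, smul_eq_mul, abs_of_pos (by positivity)]
  field_simp

lemma wk_integrable {M : ℝ} (hM : ∀ s : ℝ, 0 ≤ s → |Tk s| ≤ M) {U : ℂ → ℝ} {μ : Measure ℂ}
    (hU : Integrable U μ) (x : ℂ) {a : ℝ} (ha : 0 < a) :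
    Integrable (fun y => U y * (Tk (‖y - x‖ ^ 2 / a) / a)) μ :=
  hU.mul_bdd (c := M / a) (wk_cont x a).aestronglyMeasurable
    (Eventually.of_forall fun y => wk_bound hM x y ha)

lemma wk_vanish {x y : ℂ} {e : ℝ} (he : 0 < e) (hy : y ∉ closedBall x e) :
    Tk (‖y - x‖ ^ 2 / e ^ 2) / e ^ 2 = 0 := by
  rw [mem_closedBall, dist_eq_norm, not_le] at hy
  rw [Tk_gt, zero_div]
  rw [lt_div_iff₀ (by positivity), one_mul]
  gcongr

lemma leb (u : ℂ → ℝ) (hu : IntegrableOn u (ball (0:ℂ) 1) volume) :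
    ∀ᵐ x : ℂ, x ∈ ball (0:ℂ) 1 → Tendsto
      (fun e : ℝ => ∫ y in ball (0:ℂ) 1, u y * (Tk (‖y - x‖ ^ 2 / e ^ 2) / e ^ 2))
      (𝓝[>] 0) (𝓝 (4 * Real.pi * u x)) := by
  obtain ⟨M, hM0, hM⟩ := Tk_bdd
  set U : ℂ → ℝ := (ball (0:ℂ) 1).indicator u with hUdef
  have hU : Integrable U := (integrable_indicator_iff measurableSet_ball).2 hu
  filter_upwards [IsUnifLocDoublingMeasure.ae_tendsto_average_norm_sub volume
    hU.locallyIntegrable 1] with x hx hxD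
  have hx' := hx (l := 𝓝[>] (0:ℝ)) (fun _ : ℝ => x) (fun e => e) tendsto_id (by
    filter_upwards [self_mem_nhdsWithin] with e he
    have : (0:ℝ) < e := he
    simp [this.le])
  have hUx : U x = u x := Set.indicator_of_mem hxD u
  have hconv : ∀ e : ℝ, ∫ y in ball (0:ℂ) 1, u y * (Tk (‖y - x‖ ^ 2 / e ^ 2) / e ^ 2)
      = ∫ y, U y * (Tk (‖y - x‖ ^ 2 / e ^ 2) / e ^ 2) := by
    intro e
    rw [← integral_indicator measurableSet_ball]
    congr 1
    ext y
    by_cases hy : y ∈ ball (0:ℂ) 1 <;> simp [hUdef, hy]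
  simp_rw [hconv]
  rw [← hUx]
  rw [tendsto_iff_norm_sub_tendsto_zero]
  have hx2 := hx'.const_mul (M * Real.pi)
  rw [mul_zero] at hx2
  refine squeeze_zero' (Eventually.of_forall fun e => norm_nonneg _) ?_ hx2
  filter_upwards [self_mem_nhdsWithin] with e he
  have he : (0:ℝ) < e := he
  have hw : Integrable (fun y : ℂ => Tk (‖y - x‖ ^ 2 / e ^ 2) / e ^ 2) := by
    by_contra hcon
    have := wk_int x he
    rw [integral_undef hcon] at this
    have := Real.pi_pos
    linarith
  have h1e : (∫ y, U y * (Tk (‖y - x‖ ^ 2 / e ^ 2) / e ^ 2)) - 4 * Real.pi * U x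
      = ∫ y, (U y - U x) * (Tk (‖y - x‖ ^ 2 / e ^ 2) / e ^ 2) := by
    simp_rw [sub_mul]
    rw [integral_sub (wk_integrable hM hU x (by positivity)) (hw.const_mul _),
      integral_const_mul, wk_int x he]
    ring
  rw [h1e]
  have hUI : IntegrableOn (fun y => ‖U y - U x‖) (closedBall x e) := by
    have : IntegrableOn (fun y => U y - U x) (closedBall x e) :=
      hU.integrableOn.sub (integrableOn_const (by exact measure_closedBall_lt_top.ne))
    exact this.norm
  have h2 : ‖∫ y, (U y - U x) * (Tk (‖y - x‖ ^ 2 / e ^ 2) / e ^ 2)‖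
      ≤ ∫ y, (closedBall x e).indicator (fun y => M / e ^ 2 * ‖U y - U x‖) y := by
    refine norm_integral_le_of_norm_le
      ((integrable_indicator_iff measurableSet_closedBall).2 (hUI.const_mul _))
      (Eventually.of_forall fun y => ?_)
    by_cases hy : y ∈ closedBall x e
    · rw [Set.indicator_of_mem hy, norm_mul, mul_comm]
      have := wk_bound hM x y (a := e ^ 2) (by positivity)
      gcongr
    · rw [Set.indicator_of_notMem hy, wk_vanish he hy]; simp
  refine h2.trans (le_of_eq ?_)
  rw [integral_indicator measurableSet_closedBall, integral_const_mul, setAverage_eq]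
  have hv : (volume : Measure ℂ).real (closedBall x e) = e ^ 2 * Real.pi := by
    simp [Measure.real, Complex.volume_closedBall, he.le]
  rw [hv, smul_eq_mul]
  have := Real.pi_pos
  field_simp

lemma gk_bdd (a b : ℝ) (ha : 0 < a) (hab : a ≤ b) : ∃ B : ℝ, ∀ s, 0 ≤ s → |gk a b s| ≤ B := by
  obtain ⟨M, hM⟩ := (isCompact_Icc (a := (0:ℝ)) (b := b)).exists_bound_of_continuousOn
    (gk_contDiff a b).continuous.continuousOn
  refine ⟨max M 1, fun s hs => ?_⟩
  by_cases h : s ≤ b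
  · exact (hM s ⟨hs, h⟩).trans (le_max_left _ _)
  · rw [gk_zero ha hab (by linarith)]; simp

lemma gk_cont (a b : ℝ) (x : ℂ) : Continuous fun y : ℂ => gk a b (‖y - x‖ ^ 2) := by
  have := (gk_contDiff a b).continuous
  fun_prop

lemma rep {M : ℝ} (hM : ∀ s : ℝ, 0 ≤ s → |Tk s| ≤ M) {r d e : ℝ} (hd : 0 < d) (hdr : d + r ≤ 1)
    (he : 0 < e) (hed : e ≤ d) {u f : ℂ → ℝ} {x : ℂ} (hx : x ∈ ball (0:ℂ) r)
    (hu : IntegrableOn u (ball (0:ℂ) 1) volume)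
    (hf : IntegrableOn f (ball (0:ℂ) 1) volume)
    (heq : DistribLaplaceEq (ball (0:ℂ) 1) u f) :
    |∫ y in ball (0:ℂ) 1, u y * (Tk (‖y - x‖ ^ 2 / e ^ 2) / e ^ 2)|
      ≤ M / d ^ 2 * (∫ y in ball (0:ℂ) 1, |u y|)
        + ∫ y in ball (0:ℂ) 1, |f y| * |gk (e ^ 2) (d ^ 2) (‖y - x‖ ^ 2)| := by
  have he2 : 0 < e ^ 2 := by positivity
  have hd2 : 0 < d ^ 2 := by positivity
  have hed2 : e ^ 2 ≤ d ^ 2 := by gcongr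
  have hsupp : Function.support (fun y : ℂ => gk (e ^ 2) (d ^ 2) (‖y - x‖ ^ 2)) ⊆ ball x d := by
    intro y hy
    by_contra hcon
    rw [mem_ball, dist_eq_norm, not_lt] at hcon
    exact hy (gk_zero he2 hed2 (by gcongr))
  have hts : tsupport (fun y : ℂ => gk (e ^ 2) (d ^ 2) (‖y - x‖ ^ 2)) ⊆ closedBall x d :=
    closure_minimal (hsupp.trans ball_subset_closedBall) isClosed_closedBall
  have hφ : ContDiff ℝ (⊤ : ℕ∞) (fun y : ℂ => gk (e ^ 2) (d ^ 2) (‖y - x‖ ^ 2)) :=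
    (gk_contDiff _ _).comp ((contDiff_id.sub contDiff_const).norm_sq ℝ)
  have hE := heq _ hφ
    (HasCompactSupport.of_support_subset_isCompact (isCompact_closedBall x d)
      (hsupp.trans ball_subset_closedBall))
    (hts.trans (by
      intro y hy
      rw [mem_closedBall] at hy
      rw [mem_ball] at hx ⊢
      linarith [dist_triangle y x 0]))
  simp_rw [lap_gk he2 hd2, mul_sub] at hE
  rw [integral_sub (wk_integrable hM hu x he2) (wk_integrable hM hu x hd2)] at hE
  obtain ⟨B, hB⟩ := gk_bdd (e ^ 2) (d ^ 2) he2 hed2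
  have h1 : |∫ y in ball (0:ℂ) 1, f y * gk (e ^ 2) (d ^ 2) (‖y - x‖ ^ 2)|
      ≤ ∫ y in ball (0:ℂ) 1, |f y| * |gk (e ^ 2) (d ^ 2) (‖y - x‖ ^ 2)| := by
    refine (abs_integral_le_integral_abs).trans (le_of_eq ?_)
    simp_rw [abs_mul]
  have h2 : |∫ y in ball (0:ℂ) 1, u y * (Tk (‖y - x‖ ^ 2 / d ^ 2) / d ^ 2)|
      ≤ M / d ^ 2 * (∫ y in ball (0:ℂ) 1, |u y|) := by
    rw [← integral_const_mul, ← Real.norm_eq_abs]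
    refine norm_integral_le_of_norm_le (hu.abs.const_mul _) (Eventually.of_forall fun y => ?_)
    rw [norm_mul, mul_comm]
    have := wk_bound hM x y hd2
    rw [Real.norm_eq_abs (u y)]
    gcongr
  rw [abs_le] at h1 h2 ⊢
  constructor <;> linarith [h1.1, h1.2, h2.1, h2.2]

def bmu (f : ℂ → ℝ) (c E : ℝ) : Measure ℂ :=
  (volume.restrict (ball (0:ℂ) 1)).withDensity (fun y => ENNReal.ofReal ((|f y| + c) / E))

lemma bmu_meas {f : ℂ → ℝ} (hf : IntegrableOn f (ball (0:ℂ) 1) volume) (c E : ℝ) :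
    AEMeasurable (fun y => ENNReal.ofReal ((|f y| + c) / E)) (volume.restrict (ball (0:ℂ) 1)) :=
  ((hf.abs.aemeasurable.add_const c).div_const E).ennreal_ofReal

lemma bmu_prob {f : ℂ → ℝ} (hf : IntegrableOn f (ball (0:ℂ) 1) volume) {c E : ℝ} (hE : 0 < E)
    (hc0 : 0 ≤ c) (hc : (∫ x in ball (0:ℂ) 1, |f x|) + c * Real.pi = E) :
    IsProbabilityMeasure (bmu f c E) := by
  constructor
  have hci : IntegrableOn (fun _ : ℂ => c) (ball (0:ℂ) 1) :=
    integrableOn_const measure_ball_lt_top.ne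
  have hI : Integrable (fun y => (|f y| + c) / E) (volume.restrict (ball (0:ℂ) 1)) :=
    (hf.abs.add hci).div_const E
  unfold bmu
  rw [withDensity_apply _ MeasurableSet.univ, Measure.restrict_univ,
    ← ofReal_integral_eq_lintegral_ofReal hI
      (Eventually.of_forall fun y => by positivity), integral_div,
    integral_add hf.abs hci]
  have : ∫ _ in ball (0:ℂ) 1, c = c * Real.pi := by
    simp [Measure.real, Complex.volume_ball, mul_comm]
  rw [this, hc, div_self hE.ne', ENNReal.ofReal_one]

lemma jensen {f : ℂ → ℝ} (hf : IntegrableOn f (ball (0:ℂ) 1) volume) {c E p B : ℝ} (hE : 0 < E)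
    (hp : 0 < p)
    (hc0 : 0 ≤ c) (hc : (∫ x in ball (0:ℂ) 1, |f x|) + c * Real.pi = E)
    (k : ℂ → ℝ) (hk : Continuous k) (hkB : ∀ y, |k y| ≤ B) (x : ℂ)
    (hkx : ∀ y ∈ ball (0:ℂ) 1, y ≠ x → |k y| ≤ Real.log (8 / ‖y - x‖ ^ 2)) :
    ENNReal.ofReal (Real.exp (p * ∫ y in ball (0:ℂ) 1, |f y| * |k y|))
      ≤ ∫⁻ y, ENNReal.ofReal ((8 / ‖y - x‖ ^ 2) ^ (p * E)) ∂(bmu f c E) := by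
  haveI := bmu_prob hf hE hc0 hc
  have hbd (g : ℂ → ℝ) (hg : Integrable g (volume.restrict (ball (0:ℂ) 1))) :
      Integrable (fun y => g y * |k y|) (volume.restrict (ball (0:ℂ) 1)) :=
    hg.mul_bdd (c := B) hk.abs.aestronglyMeasurable (Eventually.of_forall fun y => by simpa using hkB y)
  have hci : IntegrableOn (fun _ : ℂ => c) (ball (0:ℂ) 1) :=
    integrableOn_const measure_ball_lt_top.ne
  have s1 : p * ∫ y in ball (0:ℂ) 1, |f y| * |k y| ≤ ∫ y, p * E * |k y| ∂(bmu f c E) := by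
    unfold bmu
    rw [integral_withDensity_eq_integral_toReal_smul₀ (bmu_meas hf c E)
      (Eventually.of_forall fun _ => ENNReal.ofReal_lt_top), ← integral_const_mul]
    have e : ∀ y, (ENNReal.ofReal ((|f y| + c) / E)).toReal • (p * E * |k y|)
        = p * ((|f y| + c) * |k y|) := by
      intro y
      rw [ENNReal.toReal_ofReal (by positivity), smul_eq_mul]
      field_simp
    simp_rw [e]
    refine integral_mono ((hbd _ hf.abs).const_mul p) ((hbd _ (hf.abs.add hci)).const_mul p)
      fun y => ?_
    have := abs_nonneg (k y)
    gcongr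
    simp only [Pi.add_apply]
    linarith
  have hB0 : 0 ≤ B := (abs_nonneg _).trans (hkB 0)
  have i1 : Integrable (fun y => p * E * |k y|) (bmu f c E) :=
    Integrable.of_bound (by fun_prop) (p * E * B) (Eventually.of_forall fun y => by
      rw [Real.norm_eq_abs, abs_of_nonneg (by positivity)]
      have := hkB y
      gcongr)
  have i2 : Integrable (fun y => Real.exp (p * E * |k y|)) (bmu f c E) :=
    Integrable.of_bound (by fun_prop) (Real.exp (p * E * B)) (Eventually.of_forall fun y => by
      rw [Real.norm_eq_abs, abs_of_nonneg (by positivity)]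
      have := hkB y
      gcongr)
  have s2 : Real.exp (∫ y, p * E * |k y| ∂(bmu f c E)) ≤ ∫ y, Real.exp (p * E * |k y|) ∂(bmu f c E) :=
    convexOn_exp.map_integral_le Real.continuous_exp.continuousOn isClosed_univ
      (Eventually.of_forall fun _ => Set.mem_univ _) i1 i2
  refine (ENNReal.ofReal_le_ofReal ((Real.exp_le_exp.2 s1).trans s2)).trans ?_
  rw [ofReal_integral_eq_lintegral_ofReal i2 (Eventually.of_forall fun y => (Real.exp_pos _).le)]
  refine lintegral_mono_ae ?_
  have hac : bmu f c E ≪ volume.restrict (ball (0:ℂ) 1) := withDensity_absolutelyContinuous _ _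
  have hne : ∀ᵐ y ∂(volume.restrict (ball (0:ℂ) 1)), y ≠ x :=
    ae_restrict_of_ae (Measure.ae_ne volume x)
  filter_upwards [hac.ae_le (ae_restrict_mem measurableSet_ball), hac.ae_le hne] with y hy hyx
  apply ENNReal.ofReal_le_ofReal
  have hpos : 0 < ‖y - x‖ := norm_pos_iff.2 (sub_ne_zero.2 hyx)
  rw [Real.rpow_def_of_pos (by positivity), mul_comm (Real.log _)]
  have := hkx y hy hyx
  gcongr

lemma kern_fin {β : ℝ} (hβ1 : β < 1) :
    ∫⁻ z in ball (0:ℂ) 2, ENNReal.ofReal ((8 / ‖z‖ ^ 2) ^ β) < ∞ := by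
  have hm : Measurable fun z : ℂ => (8 / ‖z‖ ^ 2) ^ β := by fun_prop
  have h : LocallyIntegrable (fun z : ℂ => (8 / ‖z‖ ^ 2) ^ β) volume := by
    refine locallyIntegrable_of_norm_le_rpow (C := 8 ^ β) (α := 2 * β) (by simp) ?_ ?_
      hm.aestronglyMeasurable
    · rw [Complex.finrank_real_complex]; push_cast; linarith
    · filter_upwards [Measure.ae_ne volume (0:ℂ)] with z hz
      have hz' := norm_pos_iff.2 hz
      rw [Real.norm_of_nonneg (by positivity), Real.div_rpow (by norm_num) (by positivity),
        ← Real.rpow_natCast, ← Real.rpow_mul hz'.le, Real.rpow_neg hz'.le, div_eq_mul_inv]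
      norm_num
  have h2 := (h.integrableOn_isCompact (isCompact_closedBall (0:ℂ) 2)).mono_set
    ball_subset_closedBall
  rw [← ofReal_integral_eq_lintegral_ofReal h2
    (Eventually.of_forall fun y => by positivity)]
  exact ENNReal.ofReal_lt_top

/-- Brezis–Merle type exponential integrability: if `−Δu = f` with
`‖f‖_{L¹(D)} < ε₁` and `‖u‖_{L¹(D)} < Λ₃`, then `‖e^{|u|}‖_{L^q(D_r)} < C(q, Λ₃, r)`
for every `q < 4π/ε₁`. -/
theorem statement6 (ε₁ Λ₃ r q : ℝ) (hε₁ : 0 < ε₁) (hΛ₃ : 0 < Λ₃)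
    (hr0 : 0 < r) (hr1 : r < 1) (hq0 : 0 < q) (hq : q < 4 * Real.pi / ε₁) :
    ∃ C : ℝ, 0 < C ∧
      ∀ u f : ℂ → ℝ,
        IntegrableOn u (ball (0:ℂ) 1) volume →
        IntegrableOn f (ball (0:ℂ) 1) volume →
        DistribLaplaceEq (ball (0:ℂ) 1) u f →
        (∫ x in ball (0:ℂ) 1, |f x|) < ε₁ →
        (∫ x in ball (0:ℂ) 1, |u x|) < Λ₃ →
        (∫⁻ x in ball (0:ℂ) r, ENNReal.ofReal (Real.exp |u x| ^ q)) ^ (1/q)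
          < ENNReal.ofReal C := by
  obtain ⟨M, hM0, hM⟩ := Tk_bdd
  have hpi := Real.pi_pos
  set p : ℝ := q / (4 * Real.pi) with hp
  have hp0 : 0 < p := by positivity
  set d : ℝ := 1 - r with hd
  have hd0 : 0 < d := by linarith
  have hβ1 : p * ε₁ < 1 := by
    rw [lt_div_iff₀ hε₁] at hq
    rw [hp, div_mul_eq_mul_div, div_lt_one (by positivity)]
    exact hq
  set A : ℝ≥0∞ := ∫⁻ z in ball (0:ℂ) 2, ENNReal.ofReal ((8 / ‖z‖ ^ 2) ^ (p * ε₁)) with hA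
  have hAfin : A < ∞ := kern_fin hβ1
  set K : ℝ := Real.exp (p * (M / d ^ 2 * Λ₃)) with hK
  have hfin : (ENNReal.ofReal K * A) ^ (1 / q) ≠ ∞ :=
    ENNReal.rpow_ne_top_of_nonneg (by positivity) (ENNReal.mul_lt_top ENNReal.ofReal_lt_top hAfin).ne
  refine ⟨((ENNReal.ofReal K * A) ^ (1 / q)).toReal + 1, by positivity, ?_⟩
  intro u f hu hf heq hfe hue
  refine lt_of_le_of_lt (b := (ENNReal.ofReal K * A) ^ (1 / q)) ?_ ?_
  swap
  · rw [ENNReal.lt_ofReal_iff_toReal_lt hfin]; linarith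
  refine ENNReal.rpow_le_rpow ?_ (by positivity)
  obtain ⟨c, hc0, hc⟩ : ∃ c : ℝ, 0 ≤ c ∧ (∫ x in ball (0:ℂ) 1, |f x|) + c * Real.pi = ε₁ := by
    refine ⟨(ε₁ - ∫ x in ball (0:ℂ) 1, |f x|) / Real.pi, ?_, ?_⟩
    · exact div_nonneg (by linarith) hpi.le
    · field_simp; ring
  haveI := bmu_prob hf hε₁ hc0 hc
  have hpt : ∀ᵐ x ∂(volume.restrict (ball (0:ℂ) r)), ENNReal.ofReal (Real.exp |u x| ^ q)
      ≤ ENNReal.ofReal K *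
        ∫⁻ y, ENNReal.ofReal ((8 / ‖y - x‖ ^ 2) ^ (p * ε₁)) ∂(bmu f c ε₁) := by
    filter_upwards [ae_restrict_of_ae (leb u hu), ae_restrict_mem measurableSet_ball] with x hx hxr
    have hx1 : x ∈ ball (0:ℂ) 1 := ball_subset_ball hr1.le hxr
    have hx2 := hx hx1
    have ht := (ENNReal.continuous_ofReal.tendsto _).comp
      ((Real.continuous_exp.tendsto _).comp (hx2.abs.const_mul p))
    have e1 : Real.exp |u x| ^ q = Real.exp (p * |4 * Real.pi * u x|) := by
      rw [← Real.exp_mul, abs_mul, abs_of_pos (by positivity : 0 < 4 * Real.pi), hp]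
      congr 1
      field_simp
    rw [e1]
    refine le_of_tendsto ht ?_
    filter_upwards [Ioo_mem_nhdsGT hd0] with e he
    have he0 : 0 < e := he.1
    have hed : e ≤ d := he.2.le
    have he2 : 0 < e ^ 2 := by positivity
    have hed2 : e ^ 2 ≤ d ^ 2 := by gcongr
    have hd1 : d ^ 2 ≤ 1 := by nlinarith
    have hrep := rep hM hd0 (by linarith) he0 hed hxr hu hf heq
    obtain ⟨B, hB⟩ := gk_bdd (e ^ 2) (d ^ 2) he2 hed2
    have hJ := jensen hf hε₁ hp0 hc0 hc (fun y => gk (e ^ 2) (d ^ 2) (‖y - x‖ ^ 2))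
      (gk_cont _ _ x) (fun y => hB _ (by positivity)) x (by
        intro y hy hyx
        have hpos : 0 < ‖y - x‖ := norm_pos_iff.2 (sub_ne_zero.2 hyx)
        refine gk_bound he2 hed2 hd1 (by positivity) ?_
        rw [mem_ball_zero_iff] at hy hx1
        have := norm_sub_le y x
        nlinarith)
    refine le_trans ?_ (mul_le_mul_right hJ _)
    rw [← ENNReal.ofReal_mul (by positivity), hK, ← Real.exp_add, ← mul_add]
    simp only [Function.comp_apply]
    apply ENNReal.ofReal_le_ofReal
    apply Real.exp_le_exp.2
    refine mul_le_mul_of_nonneg_left (hrep.trans ?_) hp0.le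
    gcongr
  refine (lintegral_mono_ae hpt).trans ?_
  rw [lintegral_const_mul' _ _ ENNReal.ofReal_ne_top]
  refine mul_le_mul_right ?_ _
  rw [lintegral_lintegral_swap (by
    apply Measurable.aemeasurable
    unfold Function.uncurry
    fun_prop)]
  have hin : ∀ᵐ y ∂(bmu f c ε₁),
      ∫⁻ x in ball (0:ℂ) r, ENNReal.ofReal ((8 / ‖y - x‖ ^ 2) ^ (p * ε₁)) ≤ A := by
    have hac : bmu f c ε₁ ≪ volume.restrict (ball (0:ℂ) 1) := withDensity_absolutelyContinuous _ _
    filter_upwards [hac.ae_le (ae_restrict_mem measurableSet_ball)] with y hy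
    rw [hA, ← lintegral_indicator measurableSet_ball, ← lintegral_indicator measurableSet_ball,
      
      ← lintegral_sub_left_eq_self ((ball (0:ℂ) 2).indicator _) y]
    refine lintegral_mono fun x => ?_
    by_cases hx : x ∈ ball (0:ℂ) r
    · rw [Set.indicator_of_mem hx, Set.indicator_of_mem]
      rw [mem_ball_zero_iff] at hx hy ⊢
      have := norm_sub_le y x
      linarith
    · rw [Set.indicator_of_notMem hx]; exact zero_le
  refine (lintegral_mono_ae hin).trans ?_
  simp
end
end

section
/- Let u be a harmonic function on the unit disk D such that the John–Nirenberg radius satisfies ρ(u, x, D, λ) > a > 0 for every x ∈ D_{1/2}. Then for every m ≥ 0, ‖∇u‖_{C^m(D_{1/2})} < C(a, λ, m). -/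
open MeasureTheory Filter Metric
open scoped Topology ENNReal

noncomputable section

lemma sm_mean_ball (g : ℂ → ℝ) (y : ℂ) (s : ℝ) (hs : 0 < s)
    (hc : ContinuousOn g (closedBall y s))
    (hm : ∀ r ∈ Set.Ioo (0:ℝ) s, Real.circleAverage g y r = g y) :
    ∫ z in ball y s, g z = Real.pi * s ^ 2 * g y := by
  have hpi := Real.pi_pos
  have h1 : ∫ z in ball y s, g z = ∫ z, (ball (0:ℂ) s).indicator (fun w => g (y + w)) z := by
    rw [← integral_indicator measurableSet_ball, ← integral_add_left_eq_self _ y]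
    congr 1
    ext z
    simp only [Set.indicator, mem_ball, dist_self_add_left, dist_zero_right]
  have hcm : ∀ p : ℝ × ℝ, y + Complex.polarCoord.symm p = circleMap y p.1 p.2 := by
    intro p
    rw [Complex.polarCoord_symm_apply, circleMap, Complex.exp_mul_I]
    simp
  rw [h1, ← Complex.integral_comp_polarCoord_symm]
  have h2 : ∫ p in polarCoord.target,
      p.1 • (ball (0:ℂ) s).indicator (fun w => g (y + w)) (Complex.polarCoord.symm p)
      = ∫ p in Set.Ioo 0 s ×ˢ Set.Ioo (-Real.pi) Real.pi, p.1 * g (circleMap y p.1 p.2) := by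
    rw [polarCoord_target, ← integral_indicator (measurableSet_Ioi.prod measurableSet_Ioo),
      ← integral_indicator (measurableSet_Ioo.prod measurableSet_Ioo)]
    congr 1
    ext p
    have hn := Complex.norm_polarCoord_symm p
    by_cases hp : p.1 ∈ Set.Ioi (0:ℝ) ∧ p.2 ∈ Set.Ioo (-Real.pi) Real.pi
    · have hp1 : 0 < p.1 := hp.1
      rw [Set.indicator_of_mem (by exact hp)]
      rw [abs_of_pos hp1] at hn
      by_cases hps : p.1 < s
      · rw [Set.indicator_of_mem (by rw [mem_ball_zero_iff, hn]; exact hps),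
          Set.indicator_of_mem (by exact ⟨⟨hp1, hps⟩, hp.2⟩), hcm, smul_eq_mul]
      · rw [Set.indicator_of_notMem (by rw [mem_ball_zero_iff, hn]; exact hps),
          Set.indicator_of_notMem (fun h => hps h.1.2), smul_zero]
    · rw [Set.indicator_of_notMem (by exact hp),
        Set.indicator_of_notMem (fun h => hp ⟨h.1.1, h.2⟩)]
  rw [h2, Measure.volume_eq_prod, setIntegral_prod]
  · have h3 : ∀ r ∈ Set.Ioo (0:ℝ) s,
        ∫ θ in Set.Ioo (-Real.pi) Real.pi, r * g (circleMap y r θ) = r * (2 * Real.pi * g y) := by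
      intro r hr
      rw [integral_const_mul, ← hm r hr, Real.circleAverage_def, smul_eq_mul,
        ← integral_Ioc_eq_integral_Ioo,
        ← intervalIntegral.integral_of_le (by linarith : -Real.pi ≤ Real.pi)]
      have hper : Function.Periodic (fun θ => g (circleMap y r θ)) (2 * Real.pi) := by
        intro θ
        simp only [(periodic_circleMap y r) θ]
      have := hper.intervalIntegral_add_eq (-Real.pi) 0
      rw [show -Real.pi + 2 * Real.pi = Real.pi by ring, zero_add] at this
      rw [this]
      field_simp
    rw [setIntegral_congr_fun measurableSet_Ioo h3, integral_mul_const,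
      ← integral_Ioc_eq_integral_Ioo, ← intervalIntegral.integral_of_le hs.le, integral_id]
    ring
  · rw [← Measure.volume_eq_prod]
    refine IntegrableOn.mono_set (t := Set.Icc 0 s ×ˢ Set.Icc (-Real.pi) Real.pi) ?_
      (Set.prod_mono Set.Ioo_subset_Icc_self Set.Ioo_subset_Icc_self)
    apply ContinuousOn.integrableOn_compact (isCompact_Icc.prod isCompact_Icc)
    refine continuousOn_fst.mul (hc.comp ?_ ?_)
    · unfold circleMap
      fun_prop
    · intro p hp
      exact circleMap_mem_closedBall y hp.1.1 p.2 |> fun h => closedBall_subset_closedBall hp.1.2 h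

lemma sm_harm (u : ℂ → ℝ) (hu : ContDiffOn ℝ (⊤ : ℕ∞) u (ball (0:ℂ) 1))
    (hl : ∀ x ∈ ball (0:ℂ) 1, lap u x = 0) :
    InnerProductSpace.HarmonicOnNhd u (ball 0 1) := by
  intro x hx
  refine ⟨((hu x hx).contDiffAt (isOpen_ball.mem_nhds hx)).of_le ?_, ?_⟩
  · exact WithTop.coe_le_coe.2 (le_top : (2 : ℕ∞) ≤ ⊤)
  · filter_upwards [isOpen_ball.mem_nhds hx] with z hz
    rw [InnerProductSpace.laplacian_eq_iteratedFDeriv_complexPlane]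
    exact hl z hz

lemma sm_vol (y : ℂ) (s : ℝ) (hs : 0 < s) : (volume (ball y s)).toReal = Real.pi * s ^ 2 := by
  rw [Complex.volume_ball]
  simp [ENNReal.toReal_ofReal hs.le, mul_comm]

lemma sm_osc (u : ℂ → ℝ) (x : ℂ) (a lam : ℝ) (ha : 0 < a)
    (hu : InnerProductSpace.HarmonicOnNhd u (ball x a))
    (ho : meanOsc u x (a / 2) ≤ lam) :
    ∃ c : ℝ, ∀ y ∈ ball x (a / 4), |u y - c| ≤ 4 * lam := by
  refine ⟨avgOn u (ball x (a / 2)), fun y hy => ?_⟩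
  unfold meanOsc at ho
  set c := avgOn u (ball x (a / 2)) with hcdef
  have hpi := Real.pi_pos
  have hcont : ContinuousOn u (ball x a) := hu.continuousOn
  have hsub : closedBall y (a / 4) ⊆ ball x a := by
    intro z hz
    rw [mem_ball] at *
    rw [mem_closedBall] at hz
    linarith [dist_triangle z y x]
  have hsub2 : ball y (a / 4) ⊆ ball x (a / 2) := by
    intro z hz
    rw [mem_ball] at *
    linarith [dist_triangle z y x]
  have hmean := sm_mean_ball u y (a / 4) (by positivity) (hcont.mono hsub) (by
    intro r hr
    apply InnerProductSpace.HarmonicOnNhd.circleAverage_eq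
    intro z hz
    apply hu z (hsub _)
    rw [abs_of_pos hr.1] at hz
    exact closedBall_subset_closedBall hr.2.le hz)
  have hint : IntegrableOn u (ball x (a / 2)) :=
    ((hcont.mono (closedBall_subset_ball (by linarith))).integrableOn_compact
      (isCompact_closedBall x (a / 2))).mono_set ball_subset_closedBall
  have hintc : IntegrableOn (fun z => u z - c) (ball x (a / 2)) :=
    hint.sub (integrableOn_const (by exact measure_ball_lt_top.ne))
  have h1 : ∫ z in ball y (a / 4), (u z - c) = Real.pi * (a / 4) ^ 2 * (u y - c) := by
    rw [integral_sub (hint.mono_set hsub2) (integrableOn_const (by exact measure_ball_lt_top.ne)), hmean,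
      setIntegral_const, Measure.real, sm_vol _ _ (by positivity), smul_eq_mul]
    ring
  have h2 : |∫ z in ball y (a / 4), (u z - c)| ≤ ∫ z in ball x (a / 2), |u z - c| := by
    refine (abs_integral_le_integral_abs).trans ?_
    exact setIntegral_mono_set hintc.abs (Eventually.of_forall fun _ => abs_nonneg _)
      (LE.le.eventuallyLE hsub2)
  have h3 : ∫ z in ball x (a / 2), |u z - c| ≤ lam * (Real.pi * (a / 2) ^ 2) := by
    unfold avgOn at ho
    rw [sm_vol _ _ (by positivity), inv_mul_le_iff₀ (by positivity)] at ho
    linarith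
  rw [h1, abs_mul, abs_of_pos (by positivity)] at h2
  have h4 : Real.pi * (a / 4) ^ 2 * |u y - c| ≤ Real.pi * (a / 4) ^ 2 * (4 * lam) := by
    calc _ ≤ _ := h2.trans h3
      _ = _ := by ring
  exact le_of_mul_le_mul_left h4 (by positivity)

lemma sm_deriv (u : ℂ → ℝ) (x : ℂ) (a lam : ℝ) (ha : 0 < a) (hlam : 0 < lam)
    (hu : InnerProductSpace.HarmonicOnNhd u (ball x a))
    (ho : meanOsc u x (a / 2) ≤ lam) (j : ℕ) (hj : 1 ≤ j) :
    ‖iteratedFDeriv ℝ j u x‖ ≤ j.factorial * (16 * lam) / (a / 8) ^ j := by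
  obtain ⟨c, hc⟩ := sm_osc u x a lam ha hu ho
  obtain ⟨F, hF, hFu⟩ := hu.exists_analyticOnNhd_ball_re_eq
  have hxa : x ∈ ball x a := mem_ball_self ha
  have hmem : ∀ z ∈ ball (0:ℂ) (a / 4), x + z ∈ ball x (a / 4) := by
    intro z hz
    simpa using hz
  have hss : ball x (a / 4) ⊆ ball x a := ball_subset_ball (by linarith)
  let G : ℂ → ℂ := fun z => -F x + F (x + z)
  have hGd : DifferentiableOn ℂ G (ball 0 (a / 4)) := by
    intro z hz
    have h := (hF _ (hss (hmem z hz))).differentiableAt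
    exact (((h.comp z (by fun_prop : DifferentiableAt ℂ (fun w => x + w) z))).const_add
      (-F x)).differentiableWithinAt
  have hG : ∀ z ∈ ball (0:ℂ) (a / 4), ‖G z‖ ≤ 2 * (8 * lam) * ‖z‖ / (a / 4 - ‖z‖) := by
    intro z hz
    refine Complex.borelCaratheodory_zero (by positivity) hGd ?_ (by positivity) hz (by simp [G])
    intro w hw
    have e1 := abs_le.1 (hc _ (hmem w hw))
    have e2 := abs_le.1 (hc x (mem_ball_self (by positivity)))
    have e3 : (F (x + w)).re = u (x + w) := hFu (hss (hmem w hw))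
    have e4 : (F x).re = u x := hFu hxa
    simp only [Set.mem_ofPred_eq, G, Complex.add_re, Complex.neg_re, e3, e4]
    linarith [e1.2, e2.1]
  have hC : ‖iteratedDeriv j G 0‖ ≤ j.factorial * (16 * lam) / (a / 8) ^ j := by
    apply Complex.norm_iteratedDeriv_le_of_forall_mem_sphere_norm_le j (by positivity)
    · apply DifferentiableOn.diffContOnCl
      refine hGd.mono ((closure_ball_subset_closedBall).trans
        (closedBall_subset_ball (by linarith)))
    · intro z hz
      have hz' : ‖z‖ = a / 8 := by simpa using hz
      have := hG z (by simp [hz']; linarith)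
      rw [hz'] at this
      refine this.trans (le_of_eq ?_)
      field_simp
      norm_num
  have hGF : iteratedDeriv j G 0 = iteratedDeriv j F x := by
    simp only [G]
    rw [iteratedDeriv_const_add hj, iteratedDeriv_comp_const_add]
    simp
  have hcd : ContDiffAt ℂ j F x := (hF x hxa).contDiffAt
  have hev : u =ᶠ[𝓝 x] Complex.reCLM ∘ F := by
    filter_upwards [isOpen_ball.mem_nhds hxa] with z hz
    exact (hFu hz).symm
  rw [(hev.iteratedFDeriv ℝ j).eq_of_nhds]
  have h1 := Complex.reCLM.norm_iteratedFDeriv_comp_left (hcd.restrict_scalars ℝ) le_rfl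
  have h2 : ‖iteratedFDeriv ℝ j F x‖ = ‖iteratedDeriv j F x‖ := by
    rw [← norm_iteratedFDeriv_eq_norm_iteratedDeriv, ← hcd.restrictScalars_iteratedFDeriv (𝕜 := ℝ)]
    simp
  rw [Complex.reCLM_norm, one_mul, h2, ← hGF] at h1
  exact h1.trans hC

/-- a harmonic function on `D` whose John–Nirenberg radius is bounded below on
`D_{1/2}` has all derivatives of `∇u` up to order `m` bounded on `D_{1/2}`. -/
theorem statement7 (a lam : ℝ) (ha : 0 < a) (hlam : 0 < lam) (m : ℕ) :
    ∃ C : ℝ, 0 < C ∧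
      ∀ u : ℂ → ℝ,
        ContDiffOn ℝ (⊤ : ℕ∞) u (ball (0:ℂ) 1) →
        (∀ x ∈ ball (0:ℂ) 1, lap u x = 0) →
        (∀ x ∈ ball (0:ℂ) (1/2), a < jnRad u x (ball (0:ℂ) 1) lam) →
        ∀ x ∈ ball (0:ℂ) (1/2), ∀ j : ℕ, 1 ≤ j → j ≤ m + 1 →
          ‖iteratedFDeriv ℝ j u x‖ ≤ C := by
  have hterm : ∀ j : ℕ, 0 ≤ (j.factorial : ℝ) * (16 * lam) / (a / 8) ^ j := fun j => by positivity
  refine ⟨1 + ∑ j ∈ Finset.range (m + 2), (j.factorial : ℝ) * (16 * lam) / (a / 8) ^ j, ?_, ?_⟩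
  · have := Finset.sum_nonneg (s := Finset.range (m + 2)) (fun j _ => hterm j)
    linarith
  intro u hu hl hr x hx j hj1 hj2
  obtain ⟨r, ⟨-, hr2⟩, har⟩ := exists_lt_of_lt_csSup
    (by exact ⟨0, le_rfl, fun t h1 h2 => absurd h1 (not_lt.2 h2.le)⟩) (hr x hx)
  have hsub := (hr2 a ha har).1
  have hosc := (hr2 (a / 2) (by positivity) (by linarith)).2
  have hh := sm_harm u hu hl
  have h := sm_deriv u x a lam ha hlam (fun z hz => hh z (hsub hz)) hosc j hj1
  have h' := Finset.single_le_sum (f := fun j : ℕ => (j.factorial : ℝ) * (16 * lam) / (a / 8) ^ j)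
    (fun j _ => hterm j) (Finset.mem_range.2 (by omega : j < m + 2))
  linarith
end
end
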